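/- arXiv:2307.15234 — 6 statements merged into one kernel-verified Lean document; each statement's English description precedes it below -/
import Mathlib

section
/- Every σ-conjugacy class in GL_n(E) contains a normal element; that is, for every γ ∈ GL_n(E) there exists g ∈ GL_n(E) such that all entries of σ(g⁻¹γσ(g))·(g⁻¹γσ(g)) lie in F. -/
open Polynomial

def GoodSub {F E V : Type*} [Field F] [Field E] [Algebra F E] [AddCommGroup V] [Module E V]
    [Module F V] [IsScalarTower F E V] (N : Module.End E V) (M : Submodule E V) : Prop :=
  ∃ W : Submodule F V, (∀ w ∈ W, N w ∈ W) ∧ Submodule.span E (W : Set V) = M ∧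
    2 * Module.finrank F W ≤ Module.finrank F (M.restrictScalars F)

section
variable {F E V : Type*} [Field F] [Field E] [Algebra F E] [AddCommGroup V] [Module E V]
    [Module F V] [IsScalarTower F E V] [FiniteDimensional F V]

theorem goodSub_sup (N : Module.End E V) {M₁ M₂ : Submodule E V} (h : Disjoint M₁ M₂)
    (h₁ : GoodSub (F := F) N M₁) (h₂ : GoodSub (F := F) N M₂) : GoodSub (F := F) N (M₁ ⊔ M₂) := by
  obtain ⟨W₁, a₁, b₁, c₁⟩ := h₁
  obtain ⟨W₂, a₂, b₂, c₂⟩ := h₂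
  refine ⟨W₁ ⊔ W₂, ?_, ?_, ?_⟩
  · intro w hw
    obtain ⟨x, hx, y, hy, rfl⟩ := Submodule.mem_sup.1 hw
    rw [map_add]
    exact Submodule.add_mem_sup (a₁ _ hx) (a₂ _ hy)
  · apply le_antisymm
    · rw [Submodule.span_le]
      intro w hw
      obtain ⟨x, hx, y, hy, rfl⟩ := Submodule.mem_sup.1 hw
      exact Submodule.add_mem_sup (b₁ ▸ Submodule.subset_span hx) (b₂ ▸ Submodule.subset_span hy)
    · rw [← b₁, ← b₂]
      exact sup_le (Submodule.span_mono (SetLike.coe_subset_coe.2 le_sup_left))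
        (Submodule.span_mono (SetLike.coe_subset_coe.2 le_sup_right))
  · have e1 := Submodule.finrank_sup_add_finrank_inf_eq W₁ W₂
    have e2 := Submodule.finrank_sup_add_finrank_inf_eq (M₁.restrictScalars F) (M₂.restrictScalars F)
    have e3 : M₁.restrictScalars F ⊓ M₂.restrictScalars F = ⊥ := by
      rw [eq_bot_iff]
      intro x hx
      have := (Submodule.disjoint_def.1 h) x hx.1 hx.2
      simpa using this
    have e4 : (M₁ ⊔ M₂).restrictScalars F = M₁.restrictScalars F ⊔ M₂.restrictScalars F := by
      ext x
      simp [Submodule.mem_sup]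
    rw [e3, finrank_bot] at e2
    rw [e4]
    omega

/-- semilinear compatibility -/
theorem T_aeval (σ : E ≃ₐ[F] E) (T : V ≃ₗ[F] V) (hT : ∀ (a : E) v, T (a • v) = σ a • T v)
    (N : Module.End E V) (hTN : ∀ v, T (N v) = N (T v)) (p : E[X]) (v : V) :
    T (aeval N p v) = aeval N (Polynomial.mapAlgEquiv σ p) (T v) := by
  have hpow : ∀ (k : ℕ) v, T ((N ^ k) v) = (N ^ k) (T v) := by
    intro k
    induction k with
    | zero => simp
    | succ k ih => intro v; rw [pow_succ, Module.End.mul_apply, Module.End.mul_apply, ih, hTN]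
  induction p using Polynomial.induction_on' with
  | add p q hp hq => simp [hp, hq]
  | monomial k a => simp [aeval_monomial, hT, hpow]

theorem goodSub_caseB (σ : E ≃ₐ[F] E) (θ : E) (hθ : σ θ ≠ θ)
    (T : V ≃ₗ[F] V) (hT : ∀ (a : E) v, T (a • v) = σ a • T v)
    (N : Module.End E V) (hTN : ∀ v, T (N v) = N (T v)) (q : E[X])
    (hq : IsCoprime q (Polynomial.mapAlgEquiv σ q)) :
    GoodSub (F := F) N (LinearMap.ker (aeval N q) ⊔
      LinearMap.ker (aeval N (Polynomial.mapAlgEquiv σ q))) := by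
  set U := LinearMap.ker (aeval N q) with hU
  set U' := LinearMap.ker (aeval N (Polynomial.mapAlgEquiv σ q)) with hU'
  have hdis : Disjoint U U' := Polynomial.disjoint_ker_aeval_of_isCoprime N hq
  have hmem : ∀ u, T u ∈ U' ↔ u ∈ U := by
    intro u
    rw [hU, hU', LinearMap.mem_ker, LinearMap.mem_ker, ← T_aeval σ T hT N hTN]
    simp
  let φ : V →ₗ[F] V := LinearMap.id + T.toLinearMap
  have hφ : ∀ u, φ u = u + T u := fun u => rfl
  have hNU : ∀ u ∈ U, N u ∈ U := by
    intro u hu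
    rw [hU, LinearMap.mem_ker] at hu ⊢
    have : aeval N (q * X) u = aeval N (X * q) u := by rw [mul_comm]
    simpa [hu] using this
  refine ⟨(U.restrictScalars F).map φ, ?_, ?_, ?_⟩
  · rintro _ ⟨u, hu, rfl⟩
    exact ⟨N u, hNU u hu, by simp [hφ, hTN]⟩
  · apply le_antisymm
    · rw [Submodule.span_le]
      rintro _ ⟨u, hu, rfl⟩
      exact Submodule.add_mem_sup hu ((hmem u).2 hu)
    · set S := Submodule.span E (((U.restrictScalars F).map φ : Submodule F V) : Set V)
      have key : ∀ u ∈ U, u ∈ S := by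
        intro u hu
        have h1 : u + T u ∈ S := Submodule.subset_span ⟨u, hu, rfl⟩
        have h2 : θ • u + T (θ • u) ∈ S := Submodule.subset_span ⟨θ • u, U.smul_mem _ hu, rfl⟩
        rw [hT] at h2
        have h3 : (θ - σ θ) • u ∈ S := by
          have := S.sub_mem h2 (S.smul_mem (σ θ) h1)
          convert this using 1
          module
        exact (S.smul_mem_iff (sub_ne_zero.2 (Ne.symm hθ))).1 h3
      refine sup_le key ?_
      intro u' hu'
      obtain ⟨u, rfl⟩ := T.surjective u'
      have hu := (hmem u).1 hu'
      have h1 : u + T u ∈ S := Submodule.subset_span ⟨u, hu, rfl⟩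
      simpa using S.sub_mem h1 (key u hu)
  · have e0 := Submodule.finrank_map_le φ (U.restrictScalars F)
    have e2 := Submodule.finrank_sup_add_finrank_inf_eq (U.restrictScalars F) (U'.restrictScalars F)
    have e3 : U.restrictScalars F ⊓ U'.restrictScalars F = ⊥ := by
      rw [eq_bot_iff]
      intro x hx
      have := (Submodule.disjoint_def.1 hdis) x hx.1 hx.2
      simpa using this
    have e4 : (U ⊔ U').restrictScalars F = U.restrictScalars F ⊔ U'.restrictScalars F := by
      ext x
      simp [Submodule.mem_sup]
    have e5 : (U.restrictScalars F).map T.toLinearMap = U'.restrictScalars F := by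
      ext x
      constructor
      · rintro ⟨u, hu, rfl⟩
        exact (hmem u).2 hu
      · intro hx
        obtain ⟨u, rfl⟩ := T.surjective x
        exact ⟨u, (hmem u).1 hx, rfl⟩
    have e6 := T.finrank_map_eq (U.restrictScalars F)
    have e7 : Module.finrank F (U'.restrictScalars F) = Module.finrank F (U.restrictScalars F) := by
      rw [← e5]; exact e6
    rw [e3, finrank_bot] at e2
    rw [e4]
    omega
end

theorem exists_cyclic_decomposition {E V : Type*} [Field E] [AddCommGroup V] [Module E V]
    [FiniteDimensional E V] (N : Module.End E V) (q : E[X]) (hq : Irreducible q) (k : ℕ) :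
    ∃ (d : ℕ) (v : Fin d → V) (m : Fin d → ℕ),
      (∀ i, aeval N (q ^ m i) (v i) = 0) ∧
      (∀ i, v i ∈ LinearMap.ker (aeval N (q ^ k))) ∧
      (∀ u ∈ LinearMap.ker (aeval N (q ^ k)), ∃ r : Fin d → E[X],
        u = ∑ i, aeval N (r i) (v i)) ∧
      ∑ i, (q ^ m i).natDegree ≤ Module.finrank E (LinearMap.ker (aeval N (q ^ k))) := by
  classical
  let A := Module.AEval' N
  let P : Submodule E[X] A := Submodule.torsionBy E[X] A (q ^ k)
  have hPt : Module.IsTorsion' P (Submonoid.powers q) :=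
    (Submodule.isTorsion'_powers_iff q).mpr fun x => ⟨k, Submodule.smul_torsionBy _ _⟩
  obtain ⟨d, m, ⟨e⟩⟩ := Module.torsion_by_prime_power_decomposition hq hPt
  let o : V ≃ₗ[E] A := Module.AEval'.of N
  have ho : ∀ (f : E[X]) (v : V), o (aeval N f v) = f • o v := fun f v => rfl
  have ho' : ∀ (f : E[X]) (a : A), o.symm (f • a) = aeval N f (o.symm a) := by
    intro f a
    rw [LinearEquiv.symm_apply_eq, ho, LinearEquiv.apply_symm_apply]
  have hoP : ∀ v : V, o v ∈ P ↔ v ∈ LinearMap.ker (aeval N (q ^ k)) := by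
    intro v
    rw [Submodule.mem_torsionBy_iff, LinearMap.mem_ker, ← ho, LinearEquiv.map_eq_zero_iff]
  let w : Fin d → P := fun i => e.symm (DirectSum.lof E[X] (Fin d)
    (fun i => E[X] ⧸ Submodule.span E[X] {q ^ m i}) i (Submodule.Quotient.mk 1))
  refine ⟨d, fun i => o.symm (w i : A), m, ?_, ?_, ?_, ?_⟩
  · intro i
    rw [← ho', LinearEquiv.map_eq_zero_iff, ← Submodule.coe_smul, Submodule.coe_eq_zero]
    change q ^ m i • e.symm _ = 0
    rw [← map_smul, LinearEquiv.map_eq_zero_iff, ← map_smul, ← Submodule.Quotient.mk_smul]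
    have : (Submodule.Quotient.mk (q ^ m i • (1 : E[X])) :
        E[X] ⧸ Submodule.span E[X] {q ^ m i}) = 0 := by
      rw [Submodule.Quotient.mk_eq_zero]
      simp
    rw [this, map_zero]
  · intro i
    rw [← hoP, LinearEquiv.apply_symm_apply]
    exact (w i).2
  · intro u hu
    let x : P := ⟨o u, (hoP u).2 hu⟩
    choose r hr using fun i => Submodule.Quotient.mk_surjective _ (e x i)
    refine ⟨r, ?_⟩
    have h1 : x = ∑ i, r i • w i := by
      apply e.injective
      rw [map_sum]
      have h2 : ∀ i, e (r i • w i) = DirectSum.lof E[X] (Fin d)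
          (fun i => E[X] ⧸ Submodule.span E[X] {q ^ m i}) i (e x i) := by
        intro i
        rw [map_smul, LinearEquiv.apply_symm_apply, ← map_smul, ← Submodule.Quotient.mk_smul,
          ← hr i]
        simp
      simp_rw [h2]
      exact (DirectSum.sum_univ_of (e x)).symm
    apply o.injective
    have h3 := congrArg (Subtype.val) h1
    rw [map_sum]
    simp_rw [ho, LinearEquiv.apply_symm_apply]
    simpa using h3
  · have h1 : Module.finrank E (LinearMap.ker (aeval N (q ^ k))) = Module.finrank E P := by
      refine LinearEquiv.finrank_eq
        (LinearEquiv.ofSubmodules o (LinearMap.ker (aeval N (q ^ k))) (P.restrictScalars E) ?_)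
      ext a
      constructor
      · rintro ⟨u, hu, rfl⟩
        exact (hoP u).2 hu
      · intro ha
        obtain ⟨u, rfl⟩ := o.surjective a
        exact ⟨u, (hoP u).1 ha, rfl⟩
    have hfin : ∀ i, Module.Finite E (E[X] ⧸ Submodule.span E[X] {q ^ m i}) := by
      intro i
      exact (AdjoinRoot.powerBasis (pow_ne_zero (m i) hq.ne_zero)).finite
    have h2 := (e.restrictScalars E).finrank_eq
    rw [h1, h2, Module.finrank_directSum]
    refine le_of_eq (Finset.sum_congr rfl fun i _ => ?_)
    exact finrank_quotient_span_eq_natDegree.symm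

theorem goodSub_caseA {F E V : Type*} [Field F] [Field E] [Algebra F E] [AddCommGroup V]
    [Module E V] [Module F V] [IsScalarTower F E V] [FiniteDimensional F V]
    [FiniteDimensional E V] (hdeg : Module.finrank F E = 2)
    (N : Module.End E V) (q₀ : F[X]) (hm : q₀.Monic)
    (hq : Irreducible (q₀.map (algebraMap F E))) (k : ℕ) :
    GoodSub (F := F) N (LinearMap.ker (aeval N ((q₀.map (algebraMap F E)) ^ k))) := by
  obtain ⟨d, v, m, h1, h2, h3, h4⟩ := exists_cyclic_decomposition N _ hq k
  set q := q₀.map (algebraMap F E) with hqdef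
  set U := LinearMap.ker (aeval N (q ^ k)) with hU
  have hUst : ∀ (f : E[X]) u, u ∈ U → aeval N f u ∈ U := by
    intro f u hu
    rw [hU, LinearMap.mem_ker] at hu ⊢
    rw [← Module.End.mul_apply, ← map_mul, mul_comm, map_mul, Module.End.mul_apply, hu, map_zero]
  let φ : (Fin d → F[X]) →ₗ[F] V :=
    { toFun := fun f => ∑ i, aeval N ((f i).map (algebraMap F E)) (v i)
      map_add' := by
        intro f g
        simp [Finset.sum_add_distrib]
      map_smul' := by
        intro c f
        simp [Finset.smul_sum, Algebra.smul_def] }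
  have hφ : ∀ f, φ f = ∑ i, aeval N ((f i).map (algebraMap F E)) (v i) := fun f => rfl
  have hφs : ∀ i g, φ (Pi.single i g) = aeval N (g.map (algebraMap F E)) (v i) := by
    intro i g
    rw [hφ, Finset.sum_eq_single i]
    · simp
    · intro j _ hj
      simp [Pi.single_eq_of_ne hj]
    · simp
  refine ⟨LinearMap.range φ, ?_, ?_, ?_⟩
  · rintro _ ⟨f, rfl⟩
    refine ⟨fun i => X * f i, ?_⟩
    simp [hφ]
  · apply le_antisymm
    · rw [Submodule.span_le]
      rintro _ ⟨f, rfl⟩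
      rw [hφ]
      exact U.sum_mem fun i _ => hUst _ _ (h2 i)
    · intro u hu
      obtain ⟨r, rfl⟩ := h3 u hu
      refine Submodule.sum_mem _ fun i _ => ?_
      rw [aeval_eq_sum_range, LinearMap.sum_apply]
      refine Submodule.sum_mem _ fun j _ => ?_
      rw [LinearMap.smul_apply]
      refine Submodule.smul_mem _ _ (Submodule.subset_span ⟨Pi.single i (X ^ j), ?_⟩)
      rw [hφs]
      simp
  · let ψ : (∀ i : Fin d, degreeLT F ((q₀ ^ m i).natDegree)) →ₗ[F] V :=
      φ ∘ₗ LinearMap.pi fun i => (Submodule.subtype _) ∘ₗ LinearMap.proj i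
    have hr : LinearMap.range φ ≤ LinearMap.range ψ := by
      rintro _ ⟨f, rfl⟩
      refine ⟨fun i => ⟨f i %ₘ (q₀ ^ m i), ?_⟩, ?_⟩
      · rw [mem_degreeLT, ← degree_eq_natDegree (hm.pow _).ne_zero]
        exact degree_modByMonic_lt _ (hm.pow _)
      · change φ (fun i => f i %ₘ (q₀ ^ m i)) = φ f
        rw [hφ, hφ]
        refine Finset.sum_congr rfl fun i _ => ?_
        conv_rhs => rw [← modByMonic_add_div (f i) (q₀ ^ m i)]
        have := h1 i
        rw [mul_comm]
        simp only [Polynomial.map_add, Polynomial.map_mul, map_add, map_mul, LinearMap.add_apply,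
          Module.End.mul_apply, Polynomial.map_pow]
        rw [← hqdef, h1 i]
        simp
    have i1 := Submodule.finrank_mono hr
    have hfin : ∀ i : Fin d, Module.Finite F (degreeLT F ((q₀ ^ m i).natDegree)) := fun i =>
      Module.Finite.equiv (degreeLTEquiv F _).symm
    have i2 := LinearMap.finrank_range_le ψ
    have i3 : Module.finrank F (∀ i : Fin d, degreeLT F ((q₀ ^ m i).natDegree)) =
        ∑ i, (q ^ m i).natDegree := by
      rw [Module.finrank_pi_fintype]
      refine Finset.sum_congr rfl fun i _ => ?_
      rw [(degreeLTEquiv F _).finrank_eq, Module.finrank_fin_fun, hqdef, ← Polynomial.map_pow,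
        natDegree_map]
    have i4 : Module.finrank F (U.restrictScalars F) = 2 * Module.finrank E U := by
      rw [← hdeg]
      exact (Module.finrank_mul_finrank F E U).symm
    omega

theorem goodSub_ker {F E V : Type*} [Field F] [Field E] [Algebra F E] [AddCommGroup V]
    [Module E V] [Module F V] [IsScalarTower F E V] [FiniteDimensional F V]
    [FiniteDimensional E V] (hdeg : Module.finrank F E = 2)
    (σ : E ≃ₐ[F] E) (hσ2 : ∀ x : E, σ (σ x) = x)
    (hfix : ∀ x : E, σ x = x ↔ x ∈ Set.range (algebraMap F E)) (θ : E) (hθ : σ θ ≠ θ)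
    (T : V ≃ₗ[F] V) (hT : ∀ (a : E) v, T (a • v) = σ a • T v)
    (N : Module.End E V) (hTN : ∀ v, T (N v) = N (T v)) (D : ℕ) :
    ∀ p : E[X], p ≠ 0 → Polynomial.mapAlgEquiv σ p = p → p.natDegree = D →
      GoodSub (F := F) N (LinearMap.ker (aeval N p)) := by
  have hss : ∀ p : E[X], Polynomial.mapAlgEquiv σ (Polynomial.mapAlgEquiv σ p) = p := by
    intro p
    ext i
    simp [hσ2]
  induction D using Nat.strong_induction_on with
  | _ D ih =>
  intro p hp hsp hD
  by_cases hu : IsUnit p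
  · have hker : LinearMap.ker (aeval N p) = ⊥ := by
      rw [LinearMap.ker_eq_bot']
      intro v hv
      obtain ⟨r, hr⟩ := hu.exists_left_inv
      have : aeval N (r * p) v = 0 := by simp [hv]
      simpa [hr] using this
    rw [hker]
    exact ⟨⊥, by simp, by simp, by simp⟩
  obtain ⟨q, hqm, hqi, hqp⟩ := Polynomial.exists_monic_irreducible_factor p hu
  have hqp' : Prime q := hqi.prime
  obtain ⟨r, hr, hqr⟩ := (FiniteMultiplicity.of_prime_left hqp' hp).exists_eq_pow_mul_and_not_dvd
  set k := multiplicity q p with hk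
  have hk0 : k ≠ 0 := by
    intro h0
    rw [h0, pow_zero, one_mul] at hr
    exact hqr (hr ▸ hqp)
  have hr0 : r ≠ 0 := by
    rintro rfl
    simp at hr
    exact hp hr
  have hqd : 0 < q.natDegree := hqi.natDegree_pos
  set s := Polynomial.mapAlgEquiv σ with hs
  have hsi : Irreducible (s q) := (MulEquiv.irreducible_iff s).2 hqi
  have hsm : (s q).Monic := by
    rw [hs, coe_mapAlgEquiv]
    exact hqm.map _
  by_cases hqs : s q = q
  · -- inert or ramified factor, defined over the base field
    have hsr : s r = r := by
      have h := hsp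
      rw [hr, map_mul, map_pow, hqs] at h
      exact mul_left_cancel₀ (pow_ne_zero _ hqi.ne_zero) h
    have hl : q ∈ lifts (algebraMap F E) := by
      rw [lifts_iff_coeff_lifts]
      intro i
      rw [← hfix]
      have := congrArg (fun f => f.coeff i) hqs
      simpa [hs] using this
    obtain ⟨q₀, hq₀, -, hq₀m⟩ := lifts_and_natDegree_eq_and_monic hl hqm
    have hc : IsCoprime (q ^ k) r := ((hqi.coprime_iff_not_dvd).2 hqr).pow_left
    rw [hr, ← Polynomial.sup_ker_aeval_eq_ker_aeval_mul_of_coprime N hc]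
    refine goodSub_sup N (Polynomial.disjoint_ker_aeval_of_isCoprime N hc) ?_ ?_
    · subst hq₀
      exact goodSub_caseA hdeg N q₀ hq₀m hqi k
    · refine ih r.natDegree ?_ r hr0 hsr rfl
      rw [← hD, hr, natDegree_mul (pow_ne_zero _ hqi.ne_zero) hr0, natDegree_pow]
      have := Nat.mul_pos (Nat.pos_of_ne_zero hk0) hqd
      omega
  · have hcop : IsCoprime q (s q) := by
      rw [hqi.coprime_iff_not_dvd]
      intro hdvd
      exact hqs (eq_of_monic_of_associated hsm hqm (hqi.associated_of_dvd hsi hdvd).symm)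
    have hck : IsCoprime (q ^ k) (s (q ^ k)) := by
      rw [map_pow]
      exact hcop.pow
    have hd : s (q ^ k) ∣ r := by
      have h1 : s (q ^ k) ∣ q ^ k * r := by
        refine ⟨s r, ?_⟩
        rw [← map_mul, ← hr, hsp]
      exact hck.symm.dvd_of_dvd_mul_left h1
    obtain ⟨t, ht⟩ := hd
    have hq0 : q ^ k ≠ 0 := pow_ne_zero _ hqi.ne_zero
    have hsq0 : s (q ^ k) ≠ 0 := by rw [map_pow]; exact pow_ne_zero _ hsi.ne_zero
    have ht0 : t ≠ 0 := by
      rintro rfl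
      simp at ht
      exact hr0 ht
    have hpt : p = (q ^ k * s (q ^ k)) * t := by rw [hr, ht, mul_assoc]
    have hst : s t = t := by
      have h := hsp
      rw [hpt, map_mul, map_mul, hss, mul_comm (s (q ^ k)) (q ^ k)] at h
      exact mul_left_cancel₀ (mul_ne_zero hq0 hsq0) h
    have hqt : IsCoprime (q ^ k) t := by
      refine ((hqi.coprime_iff_not_dvd).2 fun h => hqr ?_).pow_left
      rw [ht]
      exact h.mul_left _
    have hsqt : IsCoprime (s (q ^ k)) t := by
      have := hqt.map (s : E[X] →+* E[X])
      simpa [hst] using this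
    have hc : IsCoprime (q ^ k * s (q ^ k)) t := hqt.mul_left hsqt
    rw [hpt, ← Polynomial.sup_ker_aeval_eq_ker_aeval_mul_of_coprime N hc]
    refine goodSub_sup N (Polynomial.disjoint_ker_aeval_of_isCoprime N hc) ?_ ?_
    · rw [← Polynomial.sup_ker_aeval_eq_ker_aeval_mul_of_coprime N hck]
      exact goodSub_caseB σ θ hθ T hT N hTN _ hck
    · refine ih t.natDegree ?_ t ht0 hst rfl
      rw [← hD, hpt, natDegree_mul (mul_ne_zero hq0 hsq0) ht0, natDegree_mul hq0 hsq0,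
        natDegree_pow]
      have := Nat.mul_pos (Nat.pos_of_ne_zero hk0) hqd
      omega

theorem sigma_conjugacy_class_contains_normal_element
    {F E : Type*} [Field F] [Field E] [Algebra F E]
    (σ : E ≃ₐ[F] E)
    (hσ2 : ∀ x : E, σ (σ x) = x)
    (hfix : ∀ x : E, σ x = x ↔ x ∈ Set.range (algebraMap F E))
    (hdeg : Module.finrank F E = 2)
    (n : ℕ) (hn : 1 ≤ n)
    (γ : Matrix (Fin n) (Fin n) E) (hγ : IsUnit γ) :
    ∃ g : Matrix (Fin n) (Fin n) E, IsUnit g ∧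
      ∀ i j, ((((g⁻¹ * γ * g.map ⇑σ).map ⇑σ) * (g⁻¹ * γ * g.map ⇑σ)) i j)
        ∈ Set.range (algebraMap F E) := by
  classical
  have hfin : Module.Finite F E := Module.finite_of_finrank_eq_succ hdeg
  have hθ : ∃ θ : E, σ θ ≠ θ := by
    by_contra! h
    have h1 : Module.finrank F E ≤ 1 := by
      refine finrank_le_one (1 : E) fun w => ?_
      obtain ⟨c, hc⟩ := (hfix w).1 (h w)
      exact ⟨c, by rw [← hc, Algebra.smul_def, mul_one]⟩
    omega
  obtain ⟨θ, hθ⟩ := hθ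
  -- entrywise action of σ on matrices
  let S : Matrix (Fin n) (Fin n) E →+* Matrix (Fin n) (Fin n) E := (σ : E →+* E).mapMatrix
  have hS : ∀ A : Matrix (Fin n) (Fin n) E, A.map ⇑σ = S A := fun A => rfl
  have hSS : ∀ A, S (S A) = A := by
    intro A
    ext i j
    exact hσ2 _
  have hSv : ∀ (A : Matrix (Fin n) (Fin n) E) (v : Fin n → E),
      (fun i => σ (A.mulVec v i)) = (S A).mulVec (fun i => σ (v i)) := by
    intro A v
    ext i
    simp [Matrix.mulVec, dotProduct, S]
  have hSγ : IsUnit (S γ) := hγ.map S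
  have hγd : IsUnit γ.det := (Matrix.isUnit_iff_isUnit_det _).1 hγ
  let T₀ : (Fin n → E) →ₗ[F] (Fin n → E) :=
    { toFun := fun v => γ.mulVec (fun i => σ (v i))
      map_add' := by
        intro v w
        rw [← Matrix.mulVec_add]
        congr 1
        ext i
        simp
      map_smul' := by
        intro c v
        rw [RingHom.id_apply, ← Matrix.mulVec_smul]
        congr 1
        ext i
        simp }
  have hT₀ : ∀ v, T₀ v = γ.mulVec (fun i => σ (v i)) := fun v => rfl
  have hinj : Function.Injective T₀ := by
    intro v w h
    have h2 := Matrix.mulVec_injective_of_isUnit hγ h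
    ext i
    exact σ.injective (congrFun h2 i)
  let T : (Fin n → E) ≃ₗ[F] (Fin n → E) := LinearEquiv.ofInjectiveEndo T₀ hinj
  have hTT : ∀ v, T v = γ.mulVec (fun i => σ (v i)) := fun v => rfl
  have hT : ∀ (a : E) v, T (a • v) = σ a • T v := by
    intro a v
    rw [hTT, hTT, ← Matrix.mulVec_smul]
    congr 1
    ext i
    simp
  let N : Module.End E (Fin n → E) := Matrix.mulVecLin (γ * S γ)
  have hN : ∀ v, N v = T (T v) := by
    intro v
    rw [hTT, hTT, hSv, Matrix.mulVec_mulVec]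
    simp only [hσ2]
    rfl
  have hTN : ∀ v, T (N v) = N (T v) := fun v => by rw [hN, hN]
  -- a σ-invariant polynomial killing N
  let c := N.charpoly
  have hc0 : c ≠ 0 := N.charpoly_monic.ne_zero
  let p := c * Polynomial.mapAlgEquiv σ c
  have hsc0 : Polynomial.mapAlgEquiv σ c ≠ 0 := by simpa using hc0
  have hp0 : p ≠ 0 := mul_ne_zero hc0 hsc0
  have hsp : Polynomial.mapAlgEquiv σ p = p := by
    have : Polynomial.mapAlgEquiv σ (Polynomial.mapAlgEquiv σ c) = c := by
      ext i
      simp [hσ2]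
    change Polynomial.mapAlgEquiv σ (c * Polynomial.mapAlgEquiv σ c) = _
    rw [map_mul, this, mul_comm]
  have hgood := goodSub_ker hdeg σ hσ2 hfix θ hθ T hT N hTN _ p hp0 hsp rfl
  have hpN : aeval N p = 0 := by
    rw [map_mul, LinearMap.aeval_self_charpoly, zero_mul]
  rw [hpN, LinearMap.ker_zero] at hgood
  obtain ⟨W, hWN, hWs, hWd⟩ := hgood
  have hdV : Module.finrank F ((⊤ : Submodule E (Fin n → E)).restrictScalars F) = 2 * n := by
    rw [Submodule.restrictScalars_top, finrank_top, ← Module.finrank_mul_finrank F E, hdeg,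
      Module.finrank_fin_fun]
  let bW := Module.finBasis F W
  have hspan : ⊤ ≤ Submodule.span E (Set.range fun i => (bW i : Fin n → E)) := by
    rw [← hWs, Submodule.span_le]
    intro w hw
    have h1 := bW.sum_repr ⟨w, hw⟩
    have h2 := congrArg Subtype.val h1
    simp only [Submodule.coe_sum, Submodule.coe_smul] at h2
    rw [← h2]
    refine Submodule.sum_mem _ fun i _ => ?_
    rw [← algebraMap_smul E]
    exact Submodule.smul_mem _ _ (Submodule.subset_span ⟨i, rfl⟩)
  have hge : n ≤ Module.finrank F W := by
    have h1 := finrank_range_le_card (R := E) (fun i => (bW i : Fin n → E))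
    rw [Set.finrank, top_le_iff.1 hspan, finrank_top, Module.finrank_fin_fun, Fintype.card_fin] at h1
    exact h1
  have hWn : Module.finrank F W = n := by omega
  let b' := bW.reindex (finCongr hWn)
  let g : Matrix (Fin n) (Fin n) E := Matrix.of fun i j => (b' j : Fin n → E) i
  let C₀ : Matrix (Fin n) (Fin n) F := Matrix.of fun i j =>
    b'.repr ⟨N (b' j), hWN _ (b' j).2⟩ i
  let C := C₀.map (algebraMap F E)
  have hSC : S C = C := by
    ext i j
    simp [S, C]
  have hNg : (γ * S γ) * g = g * C := by
    ext i j
    have h1 := b'.sum_repr ⟨N (b' j), hWN _ (b' j).2⟩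
    have h2 := congrFun (congrArg Subtype.val h1) i
    simp only [Submodule.coe_sum, Submodule.coe_smul, Finset.sum_apply, Pi.smul_apply] at h2
    have h3 : ((γ * S γ) * g) i j = N (b' j : Fin n → E) i := rfl
    rw [h3, ← h2, Matrix.mul_apply]
    refine Finset.sum_congr rfl fun l _ => ?_
    rw [Algebra.smul_def, mul_comm]
    rfl
  have hg : IsUnit g := by
    have hsp' : ⊤ ≤ Submodule.span E (Set.range fun i => (b' i : Fin n → E)) := by
      refine hspan.trans (Submodule.span_mono ?_)
      rintro _ ⟨i, rfl⟩
      exact ⟨finCongr hWn i, by simp [b']⟩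
    have hli : LinearIndependent E (fun i => (b' i : Fin n → E)) :=
      linearIndependent_of_top_le_span_of_card_eq_finrank hsp' (by simp)
    have : LinearIndependent E g.col := hli
    exact Matrix.linearIndependent_cols_iff_isUnit.1 this
  refine ⟨g, hg, ?_⟩
  have hgd : IsUnit g.det := (Matrix.isUnit_iff_isUnit_det _).1 hg
  have hfinal : ((g⁻¹ * γ * g.map ⇑σ).map ⇑σ) * (g⁻¹ * γ * g.map ⇑σ) = C := by
    rw [hS, hS, map_mul, map_mul, hSS]
    have h1 : S g⁻¹ * S γ * g * (g⁻¹ * γ * S g) = S g⁻¹ * (S γ * γ * S g) := by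
      calc _ = S g⁻¹ * S γ * (g * g⁻¹) * γ * S g := by simp only [mul_assoc]
        _ = _ := by rw [Matrix.mul_nonsing_inv _ hgd]; simp only [mul_assoc, one_mul]
    have h2 : S γ * γ * S g = S g * C := by
      have := congrArg S hNg
      simpa only [map_mul, hSS, hSC] using this
    rw [h1, h2, ← mul_assoc, ← map_mul, Matrix.nonsing_inv_mul _ hgd, map_one, one_mul]
  intro i j
  rw [hfinal]
  exact ⟨C₀ i j, rfl⟩
end

section
/- If A ∈ Mat_n(E) is similar over E to σ(A), i.e. there exists P ∈ GL_n(E) with P⁻¹AP = σ(A), then A is similar over E to a matrix all of whose entries lie in F, i.e. there exists Q ∈ GL_n(E) such that every entry of Q⁻¹AQ lies in F. -/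
open Polynomial Module

/-- involution lemma -/
theorem exists_involution {ι X : Type*} [Fintype ι] [DecidableEq X] (f : ι → X) (s : X → X)
    (hs : ∀ x, s (s x) = x)
    (h : ∀ x, Fintype.card {i // f i = x} = Fintype.card {i // f i = s x}) :
    ∃ τ : ι → ι, (∀ i, τ (τ i) = i) ∧ ∀ i, f (τ i) = s (f i) := by
  let g : ∀ x, {i // f i = x} ≃ Fin (Fintype.card {i // f i = x}) := fun x => Fintype.equivFin _
  let r : ι → ℕ := fun i => (g (f i) ⟨i, rfl⟩ : ℕ)
  have hr : ∀ x (i : {i // f i = x}), r i.1 = g x i := by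
    rintro x ⟨i, rfl⟩; rfl
  have inj : ∀ i j, f i = f j → r i = r j → i = j := by
    intro i j hf hij
    have h1 := hr (f j) ⟨i, hf⟩
    have h2 := hr (f j) ⟨j, rfl⟩
    have : g (f j) ⟨i, hf⟩ = g (f j) ⟨j, rfl⟩ := Fin.ext (by rw [← h1, ← h2]; exact hij)
    simpa using this
  have ex : ∀ i, ∃ j, f j = s (f i) ∧ r j = r i := by
    intro i
    have hlt : r i < Fintype.card {j // f j = s (f i)} := by
      rw [← h]; exact (g (f i) ⟨i, rfl⟩).2
    refine ⟨((g (s (f i))).symm ⟨r i, hlt⟩).1, ((g (s (f i))).symm ⟨r i, hlt⟩).2, ?_⟩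
    rw [hr]; simp
  choose τ h1 h2 using ex
  exact ⟨τ, fun i => inj _ _ (by rw [h1, h1, hs]) (by rw [h2, h2]), h1⟩

theorem descent {E : Type*} [Field E] (σ : E →+* E) (a : E) (ha : σ a ≠ a)
    (n : ℕ) (A : Matrix (Fin n) (Fin n) E) (K : (Fin n → E) →+ (Fin n → E))
    (hσ2 : ∀ x : E, σ (σ x) = x)
    (hK : ∀ (c : E) v, K (c • v) = σ c • K v) (hKK : ∀ v, K (K v) = v)
    (hKA : ∀ v, K (A.mulVec v) = A.mulVec (K v)) :
    ∃ Q : Matrix (Fin n) (Fin n) E, IsUnit Q ∧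
      ∀ i j, σ ((Q⁻¹ * A * Q) i j) = (Q⁻¹ * A * Q) i j := by
  classical
  let S : Set (Fin n → E) := {v | K v = v}
  have hS : ⊤ ≤ Submodule.span E S := by
    intro v _
    have key : ∀ c : E, c • v + σ c • K v ∈ Submodule.span E S := by
      intro c
      apply Submodule.subset_span
      change K _ = _
      rw [map_add, hK, hK, hσ2, hKK, add_comm]
    have h1 := key 1
    have h2 := key a
    have h3 := Submodule.smul_mem _ (a - σ a)⁻¹
      (Submodule.sub_mem _ h2 (Submodule.smul_mem _ (σ a) h1))
    convert h3 using 1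
    have hne : a - σ a ≠ 0 := sub_ne_zero.2 (Ne.symm ha)
    rw [eq_inv_smul_iff₀ hne, map_one]
    module
  let b0 := Basis.ofSpan hS
  have hb0 : ∀ i, K (b0 i) = b0 i := fun i => Basis.ofSpan_subset hS ⟨i, rfl⟩
  haveI : Fintype _ := FiniteDimensional.fintypeBasisIndex b0
  let e := Fintype.equivFinOfCardEq (n := n) (by rw [← finrank_eq_card_basis b0]; simp)
  let b := b0.reindex e
  have hb : ∀ i, K (b i) = b i := fun i => by
    simp only [b, Basis.reindex_apply]; exact hb0 _
  let Q : Matrix (Fin n) (Fin n) E := (Pi.basisFun E (Fin n)).toMatrix b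
  have hQ : IsUnit Q := by
    letI := (Pi.basisFun E (Fin n)).invertibleToMatrix b
    exact isUnit_of_invertible Q
  have hQe : ∀ i j, Q i j = b j i := fun i j => by simp [Q, Basis.toMatrix_apply]
  refine ⟨Q, hQ, ?_⟩
  set B := Q⁻¹ * A * Q with hB
  have hQB : Q * B = A * Q := by
    rw [hB, ← mul_assoc, ← mul_assoc, Matrix.mul_nonsing_inv Q ((Matrix.isUnit_iff_isUnit_det _).1 hQ), one_mul]
  have hcol : ∀ j, ∑ i, B i j • b i = A.mulVec (b j) := by
    intro j
    ext k
    have := congrFun (congrFun hQB k) j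
    simp only [Matrix.mul_apply, hQe] at this
    simp only [Finset.sum_apply, Pi.smul_apply, smul_eq_mul, Matrix.mulVec, dotProduct]
    rw [← this]
    exact Finset.sum_congr rfl fun _ _ => mul_comm _ _
  intro i j
  have h1 : ∑ i, σ (B i j) • b i = ∑ i, B i j • b i := by
    have := congrArg K (hcol j)
    rw [hKA, hb, map_sum, ← hcol j] at this
    simpa only [hK, hb] using this
  have h2 := congrArg (fun v => b.repr v i) h1
  simpa only [Basis.repr_sum_self] using h2

theorem finrank_eq_of_ker {E M W W' : Type*} [Field E] [AddCommGroup M]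
    [AddCommGroup W] [AddCommGroup W'] [Module E W] [Module E W'] [Module E M]
    (σ : E ≃+* E) (f : M →ₗ[E] W) (f' : M →ₗ[E] W')
    (J : M ≃+ M) (hJ : ∀ (c : E) m, J (c • m) = σ c • J m)
    (hf : Function.Surjective f) (hf' : Function.Surjective f')
    (h : ∀ m, f m = 0 ↔ f' (J m) = 0) : finrank E W = finrank E W' := by
  let g : M →+ W' := f'.toAddMonoidHom.comp J.toAddMonoidHom
  have hg : Function.Surjective g := hf'.comp J.surjective
  have hker : f.toAddMonoidHom.ker = g.ker := by
    ext m; exact h m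
  let j1 := QuotientAddGroup.quotientKerEquivOfSurjective f.toAddMonoidHom hf
  let j2 := QuotientAddGroup.quotientKerEquivOfSurjective g hg
  let j := (j1.symm.trans (QuotientAddGroup.quotientAddEquivOfEq hker)).trans j2
  have hj : ∀ m, j (f m) = f' (J m) := by
    intro m
    have : j1.symm (f m) = (m : M ⧸ f.toAddMonoidHom.ker) := by
      rw [AddEquiv.symm_apply_eq]; rfl
    simp only [j, AddEquiv.trans_apply, this]
    rfl
  have := lift_rank_eq_of_equiv_equiv (R := E) (R' := E) σ j σ.bijective (by
    intro r w
    obtain ⟨m, rfl⟩ := hf w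
    rw [← map_smul, hj, hJ, map_smul, hj])
  have h2 := congrArg Cardinal.toNat this
  simpa [finrank] using h2

theorem exists_psi {E ι M : Type*} [Field E] [AddCommGroup M]
    [Module E[X] M] [Module E M] [IsScalarTower E E[X] M]
    (I : ι → Ideal E[X]) (e : M ≃ₗ[E[X]] ∀ i, E[X] ⧸ I i) (g : E[X]) :
    ∃ f : M →ₗ[E] ∀ i, E[X] ⧸ (I i ⊔ Ideal.span {g}), Function.Surjective f ∧
      ∀ m, f m = 0 ↔ ∃ m', m = g • m' := by
  let q : ∀ i, (E[X] ⧸ I i) →ₗ[E[X]] (E[X] ⧸ (I i ⊔ Ideal.span {g})) := fun i =>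
    Submodule.factor le_sup_left
  have hq : ∀ i (r : E[X]), q i (Ideal.Quotient.mk _ r) = Ideal.Quotient.mk _ r :=
    fun i r => rfl
  let f : M →ₗ[E[X]] ∀ i, E[X] ⧸ (I i ⊔ Ideal.span {g}) :=
    (LinearMap.pi fun i => (q i).comp (LinearMap.proj i)).comp e.toLinearMap
  have hf : ∀ m i, f m i = q i (e m i) := fun m i => rfl
  refine ⟨f.restrictScalars E, ?_, ?_⟩
  · intro w
    choose r hr using fun i => Ideal.Quotient.mk_surjective (w i)
    refine ⟨e.symm fun i => Ideal.Quotient.mk _ (r i), ?_⟩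
    ext i
    rw [LinearMap.restrictScalars_apply, hf, e.apply_symm_apply, hq, hr]
  · intro m
    rw [LinearMap.restrictScalars_apply]
    choose r hr using fun i => Ideal.Quotient.mk_surjective (e m i)
    constructor
    · intro h
      have h' : ∀ i, ∃ a, r i - g * a ∈ I i := by
        intro i
        have := congrFun h i
        rw [hf, ← hr, hq, Pi.zero_apply, Ideal.Quotient.eq_zero_iff_mem,
          Submodule.mem_sup] at this
        obtain ⟨y, hy, z, hz, hyz⟩ := this
        obtain ⟨a, rfl⟩ := Ideal.mem_span_singleton'.1 hz
        exact ⟨a, by rw [← hyz]; ring_nf; exact hy⟩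
      choose a ha using h'
      refine ⟨e.symm fun i => Ideal.Quotient.mk _ (a i), ?_⟩
      apply e.injective
      rw [map_smul, e.apply_symm_apply]
      ext i
      rw [← hr, Pi.smul_apply, ← Ideal.Quotient.mk_eq_mk, ← Ideal.Quotient.mk_eq_mk,
        ← Submodule.Quotient.mk_smul]
      exact (Submodule.Quotient.eq _).2 (ha i)
    · rintro ⟨m', rfl⟩
      ext i
      obtain ⟨t, ht⟩ := Ideal.Quotient.mk_surjective (e m' i)
      rw [map_smul, Pi.smul_apply, hf, ← ht, hq, Pi.zero_apply, ← Ideal.Quotient.mk_eq_mk,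
        ← Submodule.Quotient.mk_smul]
      rw [Submodule.Quotient.mk_eq_zero]
      exact Ideal.mem_sup_right (Ideal.mem_span_singleton'.2 ⟨t, by rw [smul_eq_mul, mul_comm]⟩)

theorem step_finrank {E : Type*} [Field E] (I : Ideal E[X]) {p : E[X]} (hp : Irreducible p)
    (k : ℕ) [Decidable (I ≤ Ideal.span {p ^ (k + 1)})] :
    finrank E (E[X] ⧸ (I ⊔ Ideal.span {p ^ (k + 1)})) =
      finrank E (E[X] ⧸ (I ⊔ Ideal.span {p ^ k})) +
        if I ≤ Ideal.span {p ^ (k + 1)} then p.natDegree else 0 := by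
  have hle : Ideal.span {p ^ (k + 1)} ≤ Ideal.span {p ^ k} :=
    Ideal.span_singleton_le_span_singleton.2 (pow_dvd_pow _ (Nat.le_succ k))
  split_ifs with h
  · rw [sup_eq_right.2 h, sup_eq_right.2 (h.trans hle), finrank_quotient_span_eq_natDegree,
      finrank_quotient_span_eq_natDegree, natDegree_pow, natDegree_pow]
    ring
  · have : I ⊔ Ideal.span {p ^ (k + 1)} = I ⊔ Ideal.span {p ^ k} := by
      apply le_antisymm (sup_le_sup_left hle _)
      apply sup_le le_sup_left
      obtain ⟨d, hd⟩ := (IsPrincipalIdealRing.principal (I ⊔ Ideal.span {p ^ (k + 1)})).principal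
      have hd' : I ⊔ Ideal.span {p ^ (k + 1)} = Ideal.span {d} := hd
      have h1 : d ∣ p ^ (k + 1) := by
        rw [← Ideal.span_singleton_le_span_singleton, ← hd']; exact le_sup_right
      obtain ⟨j, hj, hja⟩ := (dvd_prime_pow hp.prime _).1 h1
      rw [hd', Ideal.span_singleton_le_span_singleton]
      have hjk : j ≠ k + 1 := by
        rintro rfl
        apply h
        rw [← Ideal.span_singleton_eq_span_singleton.2 hja, ← hd']
        exact le_sup_left
      exact hja.dvd.trans (pow_dvd_pow _ (by omega))
    rw [this, add_zero]

theorem count_eq {E ι M : Type*} [Field E] [Fintype ι] [AddCommGroup M]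
    [Module E[X] M] [Module E M] [IsScalarTower E E[X] M]
    (I : ι → Ideal E[X]) (hI : ∀ i, I i ≠ ⊥) (e : M ≃ₗ[E[X]] ∀ i, E[X] ⧸ I i)
    (σ : E ≃+* E) (J : M ≃+ M) (hJ : ∀ (r : E[X]) m, J (r • m) = r.map σ.toRingHom • J m)
    {p : E[X]} (hp : Irreducible p) (hp' : Irreducible (p.map σ.toRingHom)) (k : ℕ) :
    Nat.card {i // I i ≤ Ideal.span {p ^ (k + 1)}} =
      Nat.card {i // I i ≤ Ideal.span {(p.map σ.toRingHom) ^ (k + 1)}} := by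
  classical
  have hc : ∀ g : E[X], ∑ i, finrank E (E[X] ⧸ (I i ⊔ Ideal.span {g})) =
      ∑ i, finrank E (E[X] ⧸ (I i ⊔ Ideal.span {g.map σ.toRingHom})) := by
    intro g
    obtain ⟨f, hf, hf0⟩ := exists_psi I e g
    obtain ⟨f', hf', hf0'⟩ := exists_psi I e (g.map σ.toRingHom)
    have fin : ∀ h : E[X], ∀ i, Module.Finite E (E[X] ⧸ (I i ⊔ Ideal.span {h})) := by
      intro h i
      obtain ⟨d, hd⟩ := (IsPrincipalIdealRing.principal (I i ⊔ Ideal.span {h})).principal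
      have hd' : I i ⊔ Ideal.span {h} = Ideal.span {d} := hd
      have hd0 : d ≠ 0 := by
        rintro rfl
        apply hI i
        rw [eq_bot_iff, ← Ideal.span_singleton_eq_bot.2 (rfl : (0 : E[X]) = 0), ← hd']
        exact le_sup_left
      rw [hd']
      exact (AdjoinRoot.powerBasis hd0).finite
    have := fin g
    have := fin (g.map σ.toRingHom)
    rw [← finrank_pi_fintype E, ← finrank_pi_fintype E]
    refine finrank_eq_of_ker σ f f' J ?_ hf hf' ?_
    · intro c m
      have := hJ (C c) m
      rw [map_C] at this
      have hC : ∀ (c : E) (m : M), (C c : E[X]) • m = c • m := fun c m => by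
        rw [← algebraMap_eq, algebraMap_smul]
      rw [hC, hC] at this
      exact this
    · intro m
      rw [hf0, hf0']
      constructor
      · rintro ⟨m', rfl⟩
        exact ⟨J m', hJ _ _⟩
      · rintro ⟨m', h⟩
        refine ⟨J.symm m', J.injective ?_⟩
        rw [h, hJ, J.apply_symm_apply]
  have h1 := hc (p ^ (k + 1))
  have h0 := hc (p ^ k)
  rw [Polynomial.map_pow] at h1 h0
  simp only [step_finrank (I _) hp, step_finrank (I _) hp', Finset.sum_add_distrib, h0] at h1
  have h2 := Nat.add_left_cancel h1
  rw [natDegree_map, Finset.sum_ite, Finset.sum_ite] at h2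
  simp only [Finset.sum_const, Finset.sum_const_zero, add_zero, smul_eq_mul] at h2
  have h3 := Nat.eq_of_mul_eq_mul_right hp.natDegree_pos h2
  rw [Nat.card_eq_fintype_card, Nat.card_eq_fintype_card, Fintype.card_subtype,
    Fintype.card_subtype, h3]

theorem exists_semilinear_involution {E M : Type*} [Field E] [AddCommGroup M]
    [Module E[X] M] [Module E M] [IsScalarTower E E[X] M] [Module.Finite E[X] M]
    (hM : Module.IsTorsion E[X] M)
    (σ : E ≃+* E) (hσ2 : ∀ x, σ (σ x) = x)
    (J : M ≃+ M) (hJ : ∀ (r : E[X]) m, J (r • m) = r.map σ.toRingHom • J m) :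
    ∃ K : M →+ M, (∀ (r : E[X]) m, K (r • m) = r.map σ.toRingHom • K m) ∧
      ∀ m, K (K m) = m := by
  classical
  obtain ⟨ι, _, p, hp, ex, ⟨e0⟩⟩ := Module.equiv_directSum_of_isTorsion hM
  let I : ι → Ideal E[X] := fun i => Ideal.span {p i ^ ex i}
  have hIdef : ∀ i, I i = Ideal.span {p i ^ ex i} := fun i => rfl
  let e : M ≃ₗ[E[X]] ∀ i, E[X] ⧸ I i :=
    e0.trans (DirectSum.linearEquivFunOnFintype E[X] ι fun i => E[X] ⧸ I i)
  have hI : ∀ i, I i ≠ ⊥ := fun i => by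
    rw [hIdef, Ne, Ideal.span_singleton_eq_bot]
    exact pow_ne_zero _ (hp i).ne_zero
  have hmm : ∀ r : E[X], (r.map σ.toRingHom).map σ.toRingHom = r := by
    intro r
    ext k
    simp [coeff_map, hσ2]
  let s : Ideal E[X] → Ideal E[X] := Ideal.map (mapRingHom σ.toRingHom)
  have hs_span : ∀ g : E[X], s (Ideal.span {g}) = Ideal.span {g.map σ.toRingHom} := by
    intro g
    simp [s, Ideal.map_span]
  have hss : ∀ x, s (s x) = x := by
    intro x
    have : (mapRingHom σ.toRingHom).comp (mapRingHom σ.toRingHom) = RingHom.id E[X] :=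
      RingHom.ext hmm
    simp only [s]
    rw [Ideal.map_map, this, Ideal.map_id]
  have hirr : ∀ q : E[X], Irreducible q → Irreducible (q.map σ.toRingHom) := by
    intro q hq
    exact (MulEquiv.irreducible_iff (Polynomial.mapEquiv σ)).2 hq
  have hcard : ∀ (q : E[X]) (hq : Irreducible q) (k : ℕ),
      (Fintype.card {i // I i = Ideal.span {q ^ (k + 1)}}) +
      Fintype.card {i // I i ≤ Ideal.span {q ^ (k + 1 + 1)}} =
      Fintype.card {i // I i ≤ Ideal.span {q ^ (k + 1)}} := by
    intro q hq k
    rw [Fintype.card_subtype, Fintype.card_subtype, Fintype.card_subtype,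
      ← Finset.card_union_of_disjoint]
    · congr 1
      ext i
      simp only [Finset.mem_union, Finset.mem_filter, Finset.mem_univ, true_and]
      constructor
      · rintro (h | h)
        · exact h.le
        · exact h.trans (Ideal.span_singleton_le_span_singleton.2 (pow_dvd_pow _ (Nat.le_succ _)))
      · intro h
        rw [hIdef, Ideal.span_singleton_le_span_singleton] at h
        have hd : q ∣ p i := hq.prime.dvd_of_dvd_pow ((dvd_pow_self q (Nat.succ_ne_zero k)).trans h)
        have has : Associated q (p i) := (hq.dvd_irreducible_iff_associated (hp i)).1 hd
        have hI' : I i = Ideal.span {q ^ ex i} := by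
          rw [hIdef, Ideal.span_singleton_eq_span_singleton]
          exact (has.pow_pow).symm
        have hle : k + 1 ≤ ex i := by
          rw [← (has.pow_pow (n := ex i)).dvd_iff_dvd_right] at h
          exact (pow_dvd_pow_iff hq.ne_zero hq.not_isUnit).1 h
        rcases hle.eq_or_lt with h' | h'
        · left; rw [hI', h']
        · right
          rw [hI', Ideal.span_singleton_le_span_singleton]
          exact pow_dvd_pow _ h'
    · rw [Finset.disjoint_filter]
      intro i _ h h'
      rw [h, Ideal.span_singleton_le_span_singleton,
        pow_dvd_pow_iff hq.ne_zero hq.not_isUnit] at h'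
      omega
  have hcount : ∀ x, Fintype.card {i // I i = x} = Fintype.card {i // I i = s x} := by
    intro x
    by_cases hx : ∃ q : E[X], Irreducible q ∧ ∃ k : ℕ, x = Ideal.span {q ^ (k + 1)}
    · obtain ⟨q, hq, k, rfl⟩ := hx
      rw [hs_span, Polynomial.map_pow]
      have h1 := hcard q hq k
      have h2 := hcard _ (hirr q hq) k
      have h3 := count_eq I hI e σ J hJ hq (hirr q hq) k
      have h4 := count_eq I hI e σ J hJ hq (hirr q hq) (k + 1)
      simp only [Nat.card_eq_fintype_card] at h3 h4
      omega
    · by_cases hT : x = ⊤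
      · subst hT
        simp only [s, Ideal.map_top]
      · have hno : ∀ q : E[X], Irreducible q → ∀ k : ℕ, x ≠ Ideal.span {q ^ k} := by
          intro q hq k h
          cases k with
          | zero => exact hT (by rw [h, pow_zero, Ideal.span_singleton_one])
          | succ k => exact hx ⟨q, hq, k, h⟩
        have e1 : IsEmpty {i // I i = x} := ⟨fun ⟨i, hi⟩ => hno _ (hp i) (ex i) hi.symm⟩
        have e2 : IsEmpty {i // I i = s x} := ⟨fun ⟨i, hi⟩ =>
          hno _ (hirr _ (hp i)) (ex i) (by
            rw [← hss x, ← hi, hIdef, hs_span, Polynomial.map_pow])⟩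
        rw [Fintype.card_eq_zero, Fintype.card_eq_zero]
  obtain ⟨τ, hττ, hτ⟩ := exists_involution I s hss hcount
  have hle : ∀ i, I (τ i) ≤ (I i).comap (mapRingHom σ.toRingHom) := by
    intro i
    rw [← Ideal.map_le_iff_le_comap]
    change s (I (τ i)) ≤ _
    rw [hτ, hss]
  let K' : (∀ i, E[X] ⧸ I i) →+ (∀ i, E[X] ⧸ I i) :=
    { toFun := fun w i => Ideal.quotientMap (I i) (mapRingHom σ.toRingHom) (hle i) (w (τ i))
      map_zero' := by ext i; simp
      map_add' := fun v w => by ext i; simp }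
  have hK' : ∀ r : ι → E[X], K' (fun i => Ideal.Quotient.mk _ (r i)) =
      fun i => Ideal.Quotient.mk _ ((r (τ i)).map σ.toRingHom) := by
    intro r
    ext i
    exact Ideal.quotientMap_mk (f := mapRingHom σ.toRingHom) (H := hle i)
  have hlift : ∀ w : ∀ i, E[X] ⧸ I i, ∃ r : ι → E[X], w = fun i => Ideal.Quotient.mk _ (r i) := by
    intro w
    choose r hr using fun i => Ideal.Quotient.mk_surjective (w i)
    exact ⟨r, funext fun i => (hr i).symm⟩
  have hsm : ∀ (c : E[X]) (r : ι → E[X]),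
      (c • (fun i => Ideal.Quotient.mk (I i) (r i)) : ∀ i, E[X] ⧸ I i) =
      fun i => Ideal.Quotient.mk (I i) (c * r i) := fun c r => rfl
  refine ⟨(e.symm.toAddEquiv.toAddMonoidHom.comp K').comp e.toAddEquiv.toAddMonoidHom, ?_, ?_⟩
  · intro c m
    change e.symm (K' (e (c • m))) = _ • e.symm (K' (e m))
    rw [← map_smul, map_smul]
    congr 1
    obtain ⟨r, hr⟩ := hlift (e m)
    rw [hr, hsm, hK', hK', hsm]
    simp only [Polynomial.map_mul]
  · intro m
    change e.symm (K' (e (e.symm (K' (e m))))) = m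
    rw [e.apply_symm_apply, e.symm_apply_eq]
    obtain ⟨r, hr⟩ := hlift (e m)
    rw [hr, hK', hK']
    simp only [hmm, hττ]

theorem similar_to_sigma_conjugate_implies_similar_to_rational
    {F E : Type*} [Field F] [Field E] [Algebra F E]
    (σ : E ≃ₐ[F] E)
    (hσ2 : ∀ x : E, σ (σ x) = x)
    (hfix : ∀ x : E, σ x = x ↔ x ∈ Set.range (algebraMap F E))
    (hdeg : Module.finrank F E = 2)
    (n : ℕ) (hn : 1 ≤ n)
    (A : Matrix (Fin n) (Fin n) E)
    (P : Matrix (Fin n) (Fin n) E) (hP : IsUnit P)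
    (hAP : P⁻¹ * A * P = A.map ⇑σ) :
    ∃ Q : Matrix (Fin n) (Fin n) E, IsUnit Q ∧
      ∀ i j, (Q⁻¹ * A * Q) i j ∈ Set.range (algebraMap F E) := by
  classical
  have hPdet := (Matrix.isUnit_iff_isUnit_det _).1 hP
  obtain ⟨a, ha⟩ : ∃ a : E, σ a ≠ a := by
    by_contra! hall
    have hbij : Function.Bijective (algebraMap F E) :=
      ⟨(algebraMap F E).injective, fun x => (hfix x).1 (hall x)⟩
    have h1 := (LinearEquiv.ofBijective (Algebra.linearMap F E) hbij).finrank_eq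
    rw [hdeg, Module.finrank_self] at h1
    omega
  have hPA : P * A.map σ = A * P := by
    rw [← hAP, ← mul_assoc, ← mul_assoc, Matrix.mul_nonsing_inv P hPdet, one_mul]
  have hσmul : ∀ (B : Matrix (Fin n) (Fin n) E) (v : Fin n → E),
      (fun i => σ (B.mulVec v i)) = (B.map σ).mulVec fun i => σ (v i) := by
    intro B v
    ext i
    simp [Matrix.mulVec, dotProduct]
  let J0 : (Fin n → E) ≃+ (Fin n → E) :=
    { toFun := fun v => P.mulVec fun i => σ (v i)
      invFun := fun v i => σ (P⁻¹.mulVec v i)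
      left_inv := fun v => by
        ext i
        simp [Matrix.mulVec_mulVec, Matrix.nonsing_inv_mul P hPdet, hσ2]
      right_inv := fun v => by
        simp [Matrix.mulVec_mulVec, Matrix.mul_nonsing_inv P hPdet, hσ2]
      map_add' := fun v w => by
        rw [← Matrix.mulVec_add]
        congr 1
        ext i
        simp }
  have hJ0 : ∀ v, J0 v = P.mulVec fun i => σ (v i) := fun v => rfl
  have hJ0s : ∀ (c : E) v, J0 (c • v) = σ c • J0 v := by
    intro c v
    rw [hJ0, hJ0, ← Matrix.mulVec_smul]
    congr 1
    ext i
    simp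
  have hJ0A : ∀ v, J0 (A.mulVec v) = A.mulVec (J0 v) := by
    intro v
    rw [hJ0, hJ0, hσmul, Matrix.mulVec_mulVec, hPA, ← Matrix.mulVec_mulVec]
  let T := Matrix.toLin' A
  let o := AEval'.of T
  let J : AEval' T ≃+ AEval' T := (o.symm.toAddEquiv.trans J0).trans o.toAddEquiv
  have hJo : ∀ v, J (o v) = o (J0 v) := fun v => by
    change o (J0 (o.symm (o v))) = _
    rw [o.symm_apply_apply]
  have hX : ∀ v, (X : E[X]) • o v = o (A.mulVec v) := fun v => by
    rw [AEval'.X_smul_of]; rfl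
  have hC : ∀ (c : E) v, (C c : E[X]) • o v = o (c • v) := fun c v => by
    rw [map_smul]; exact AEval.C_smul ..
  have hJ : ∀ (r : E[X]) m, J (r • m) = r.map σ.toRingEquiv.toRingHom • J m := by
    intro r
    induction r using Polynomial.induction_on' with
    | add p q hp hq =>
      intro m
      rw [add_smul, map_add, hp, hq, Polynomial.map_add, add_smul]
    | monomial k c =>
      induction k with
      | zero =>
        intro m
        obtain ⟨v, rfl⟩ := o.surjective m
        rw [monomial_zero_left, map_C, hC, hJo, hJo, hC, hJ0s]
        rfl
      | succ k ih =>
        intro m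
        obtain ⟨v, rfl⟩ := o.surjective m
        rw [← monomial_mul_X, mul_smul, ih, Polynomial.map_mul, mul_smul, map_X, hX, hJo, hJo,
          hX, hJ0A]
  have hTor : Module.IsTorsion E[X] (AEval' T) :=
    Module.AEval.isTorsion_of_finiteDimensional E (Fin n → E) T
  obtain ⟨K, hK, hKK⟩ := exists_semilinear_involution hTor σ.toRingEquiv hσ2 J hJ
  let K0 : (Fin n → E) →+ (Fin n → E) :=
    (o.symm.toAddEquiv.toAddMonoidHom.comp K).comp o.toAddEquiv.toAddMonoidHom
  have hK0 : ∀ v, K0 v = o.symm (K (o v)) := fun v => rfl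
  obtain ⟨Q, hQ, h⟩ := descent (σ : E →+* E) a ha n A K0 hσ2 (by
      intro c v
      rw [hK0, hK0, ← hC, hK, map_C]
      obtain ⟨w, hw⟩ := o.surjective (K (o v))
      rw [← hw, hC, o.symm_apply_apply, o.symm_apply_apply]
      rfl) (by
      intro v
      rw [hK0, hK0, o.apply_symm_apply, hKK, o.symm_apply_apply]) (by
      intro v
      rw [hK0, hK0, ← hX, hK, map_X]
      obtain ⟨w, hw⟩ := o.surjective (K (o v))
      rw [← hw, hX, o.symm_apply_apply, o.symm_apply_apply])
  exact ⟨Q, hQ, fun i j => (hfix _).1 (h i j)⟩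
end

section
/- Let β ∈ GL_n(E) be skew-Hermitian, let ζ ∈ GL_n(E) be normal with respect to β, and suppose β⁻¹ζ*βζ is regular semisimple. Then T_ζ := {(g, h) ∈ U_n^β(F) × U_n^β(F) : g⁻¹ζh = ζ} is contained in the diagonal; precisely, T_ζ = {(h, h) : h ∈ U_n^β(F) and hζ = ζh}, so T_ζ is identified with the centralizer of ζ in U_n^β(F). -/
/-!
STATEMENT 3: For β skew-Hermitian, ζ normal with respect to β, and β⁻¹ζ*βζ regular
semisimple, the twisted centralizer
T_ζ = {(g, h) ∈ U_n^β(F) × U_n^β(F) : g⁻¹ζh = ζ} is the diagonal copy of the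
centralizer of ζ in U_n^β(F).
-/

open Matrix

/-- A square matrix over a field `E` is regular semisimple if its characteristic
polynomial has `n` distinct roots in an algebraic closure of `E`. -/
def IsRegSemisimple {n : ℕ} {E : Type*} [Field E] (A : Matrix (Fin n) (Fin n) E) : Prop :=
  Multiset.card ((A.charpoly.map (algebraMap E (AlgebraicClosure E))).roots) = n ∧
    ((A.charpoly.map (algebraMap E (AlgebraicClosure E))).roots).Nodup

/-- Matrices commuting with a diagonal matrix with distinct entries commute. -/
lemma commute_of_diagonal {n : ℕ} {K : Type*} [Field K] (d : Fin n → K)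
    (hd : Function.Injective d) (B : Matrix (Fin n) (Fin n) K)
    (hB : Matrix.diagonal d * B = B * Matrix.diagonal d) :
    B = Matrix.diagonal (fun i => B i i) := by
  ext i j
  by_cases hij : i = j
  · subst hij; simp
  · rw [Matrix.diagonal_apply_ne _ hij]
    have := congrFun (congrFun hB i) j
    rw [Matrix.diagonal_mul, Matrix.mul_diagonal] at this
    have h2 : (d i - d j) * B i j = 0 := by rw [sub_mul, this]; ring
    rcases mul_eq_zero.1 h2 with h | h
    · exact absurd (hd (sub_eq_zero.1 h)) hij
    · exact h

/-- The centralizer of a matrix with `n` distinct eigenvalues is commutative. -/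
lemma commute_of_eigen {n : ℕ} {K : Type*} [Field K] (A : Matrix (Fin n) (Fin n) K)
    (d : Fin n → K) (hd : Function.Injective d) (hr : ∀ i, A.charpoly.eval (d i) = 0)
    (B C : Matrix (Fin n) (Fin n) K) (hB : A * B = B * A) (hC : A * C = C * A) :
    B * C = C * B := by
  have hv : ∀ i, ∃ v : Fin n → K, v ≠ 0 ∧ A *ᵥ v = d i • v := by
    intro i
    have h := hr i
    rw [Matrix.eval_charpoly] at h
    obtain ⟨v, hv0, hv⟩ := Matrix.exists_mulVec_eq_zero_iff.2 h
    refine ⟨v, hv0, ?_⟩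
    rw [Matrix.sub_mulVec, sub_eq_zero] at hv
    rw [← hv]
    ext j
    simp [Matrix.scalar_apply, Matrix.mulVec_diagonal]
  choose v hv0 hv using hv
  have hli : LinearIndependent K v := by
    refine Module.End.eigenvectors_linearIndependent' (Matrix.toLin' A) d hd v ?_
    intro i
    refine ⟨Module.End.mem_eigenspace_iff.2 ?_, hv0 i⟩
    rw [Matrix.toLin'_apply, hv]
  let P : Matrix (Fin n) (Fin n) K := (Matrix.of v)ᵀ
  have hP : IsUnit P := by
    have : IsUnit (Matrix.of v) := Matrix.linearIndependent_rows_iff_isUnit.1 hli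
    exact (Matrix.isUnit_transpose _).2 this
  have hPd : IsUnit P.det := (Matrix.isUnit_iff_isUnit_det _).1 hP
  have hAP : A * P = P * Matrix.diagonal d := by
    ext i j
    rw [Matrix.mul_diagonal]
    have := congrFun (hv j) i
    simp only [Pi.smul_apply, smul_eq_mul] at this
    calc (A * P) i j = (A *ᵥ v j) i := rfl
      _ = d j * v j i := this
      _ = P i j * d j := mul_comm _ _
  have key : ∀ B : Matrix (Fin n) (Fin n) K, A * B = B * A →
      ∃ e : Fin n → K, B * P = P * Matrix.diagonal e := by
    intro B hB
    refine ⟨fun i => (P⁻¹ * B * P) i i, ?_⟩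
    rw [← commute_of_diagonal d hd (P⁻¹ * B * P) ?_]
    · rw [Matrix.mul_assoc, Matrix.mul_nonsing_inv_cancel_left _ _ hPd]
    · apply hP.mul_left_cancel
      calc P * (Matrix.diagonal d * (P⁻¹ * B * P))
          = (P * Matrix.diagonal d) * P⁻¹ * B * P := by simp only [Matrix.mul_assoc]
        _ = A * B * P := by rw [← hAP, Matrix.mul_nonsing_inv_cancel_right _ _ hPd]
        _ = B * (P * Matrix.diagonal d) := by rw [hB, Matrix.mul_assoc, hAP]
        _ = P * (P⁻¹ * (B * (P * Matrix.diagonal d))) :=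
            (Matrix.mul_nonsing_inv_cancel_left _ _ hPd).symm
        _ = _ := by simp only [Matrix.mul_assoc]
  obtain ⟨b, hb⟩ := key B hB
  obtain ⟨c, hc⟩ := key C hC
  apply hP.mul_right_cancel
  rw [Matrix.mul_assoc, hc, ← Matrix.mul_assoc, hb, Matrix.mul_assoc C, hb, ← Matrix.mul_assoc C,
    hc, Matrix.mul_assoc, Matrix.mul_assoc, Matrix.diagonal_mul_diagonal,
    Matrix.diagonal_mul_diagonal]
  simp only [mul_comm]

/-- The centralizer of a regular semisimple matrix is commutative. -/
lemma commute_of_regSemisimple {n : ℕ} {E : Type*} [Field E] (A : Matrix (Fin n) (Fin n) E)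
    (hA : IsRegSemisimple A) (B C : Matrix (Fin n) (Fin n) E)
    (hB : A * B = B * A) (hC : A * C = C * A) : B * C = C * B := by
  classical
  let f := algebraMap E (AlgebraicClosure E)
  obtain ⟨h1, h2⟩ := hA
  set s := (A.charpoly.map (algebraMap E (AlgebraicClosure E))).roots with hs
  have hcard : s.toFinset.card = n := by rw [Multiset.toFinset_card_of_nodup h2, h1]
  let e := s.toFinset.equivFinOfCardEq hcard
  have hinj : Function.Injective (fun M : Matrix (Fin n) (Fin n) E => M.map f) :=
    Matrix.map_injective f.injective
  apply hinj
  simp only [Matrix.map_mul]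
  refine commute_of_eigen (A.map f) (fun i => (e.symm i : AlgebraicClosure E))
    (Subtype.val_injective.comp e.symm.injective) ?_ _ _ ?_ ?_
  · intro i
    have hm := (e.symm i).2
    rw [Multiset.mem_toFinset] at hm
    rw [Matrix.charpoly_map]
    exact Polynomial.isRoot_of_mem_roots hm
  · rw [← Matrix.map_mul, hB, Matrix.map_mul]
  · rw [← Matrix.map_mul, hC, Matrix.map_mul]

theorem unitary_twisted_centralizer_eq_diagonal_centralizer
    {F E : Type*} [Field F] [Field E] [Algebra F E]
    (σ : E ≃ₐ[F] E)
    (hσ2 : ∀ x : E, σ (σ x) = x)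
    (hfix : ∀ x : E, σ x = x ↔ x ∈ Set.range (algebraMap F E))
    (hdeg : Module.finrank F E = 2)
    (n : ℕ) (hn : 1 ≤ n)
    (β : Matrix (Fin n) (Fin n) E) (hβ : IsUnit β)
    (hskew : (β.map ⇑σ)ᵀ = -β)
    (ζ : Matrix (Fin n) (Fin n) E) (hζ : IsUnit ζ)
    (hnormal : ζ * (β⁻¹ * (ζ.map ⇑σ)ᵀ * β * ζ) = (β⁻¹ * (ζ.map ⇑σ)ᵀ * β * ζ) * ζ)
    (hrss : IsRegSemisimple (β⁻¹ * (ζ.map ⇑σ)ᵀ * β * ζ)) :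
    {gh : Matrix (Fin n) (Fin n) E × Matrix (Fin n) (Fin n) E |
        (IsUnit gh.1 ∧ (gh.1.map ⇑σ)ᵀ * β * gh.1 = β) ∧
        (IsUnit gh.2 ∧ (gh.2.map ⇑σ)ᵀ * β * gh.2 = β) ∧
        gh.1⁻¹ * ζ * gh.2 = ζ} =
    {gh : Matrix (Fin n) (Fin n) E × Matrix (Fin n) (Fin n) E |
        ∃ h : Matrix (Fin n) (Fin n) E,
          (IsUnit h ∧ (h.map ⇑σ)ᵀ * β * h = β) ∧ h * ζ = ζ * h ∧ gh = (h, h)} := by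
  ext ⟨g, h⟩
  simp only [Set.mem_ofPred_eq, Prod.mk.injEq]
  constructor
  · rintro ⟨⟨hg, hgU⟩, ⟨hh, hhU⟩, heq⟩
    have hgd : IsUnit g.det := (Matrix.isUnit_iff_isUnit_det _).1 hg
    have hβd : IsUnit β.det := (Matrix.isUnit_iff_isUnit_det _).1 hβ
    have hhd : IsUnit h.det := (Matrix.isUnit_iff_isUnit_det _).1 hh
    have e1 : ζ * h = g * ζ := by
      have := congrArg (g * ·) heq
      simpa only [Matrix.mul_assoc, Matrix.mul_nonsing_inv_cancel_left _ _ hgd] using this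
    have e2 : (h.map ⇑σ)ᵀ * (ζ.map ⇑σ)ᵀ = (ζ.map ⇑σ)ᵀ * (g.map ⇑σ)ᵀ := by
      have := congrArg (fun M : Matrix (Fin n) (Fin n) E => (M.map ⇑σ)ᵀ) e1
      simpa only [Matrix.map_mul, Matrix.transpose_mul] using this
    have hhs : IsUnit (h.map ⇑σ)ᵀ := by
      refine isUnit_of_mul_isUnit_left (y := β * h) ?_
      rw [← Matrix.mul_assoc, hhU]; exact hβ
    have e3 : (ζ.map ⇑σ)ᵀ * β * g = β * h * (β⁻¹ * (ζ.map ⇑σ)ᵀ * β) := by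
      apply hhs.mul_left_cancel
      calc (h.map ⇑σ)ᵀ * ((ζ.map ⇑σ)ᵀ * β * g)
          = ((h.map ⇑σ)ᵀ * (ζ.map ⇑σ)ᵀ) * β * g := by simp only [Matrix.mul_assoc]
        _ = (ζ.map ⇑σ)ᵀ * ((g.map ⇑σ)ᵀ * β * g) := by
            rw [e2]; simp only [Matrix.mul_assoc]
        _ = (ζ.map ⇑σ)ᵀ * β := by rw [hgU]
        _ = β * (β⁻¹ * ((ζ.map ⇑σ)ᵀ * β)) :=
            (Matrix.mul_nonsing_inv_cancel_left _ _ hβd).symm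
        _ = ((h.map ⇑σ)ᵀ * β * h) * (β⁻¹ * ((ζ.map ⇑σ)ᵀ * β)) := by rw [hhU]
        _ = _ := by simp only [Matrix.mul_assoc]
    have e4 : (β⁻¹ * (ζ.map ⇑σ)ᵀ * β * ζ) * h = h * (β⁻¹ * (ζ.map ⇑σ)ᵀ * β * ζ) := by
      calc (β⁻¹ * (ζ.map ⇑σ)ᵀ * β * ζ) * h
          = β⁻¹ * (ζ.map ⇑σ)ᵀ * β * (ζ * h) := by simp only [Matrix.mul_assoc]
        _ = β⁻¹ * ((ζ.map ⇑σ)ᵀ * β * g) * ζ := by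
            rw [e1]; simp only [Matrix.mul_assoc]
        _ = β⁻¹ * (β * (h * (β⁻¹ * (ζ.map ⇑σ)ᵀ * β * ζ))) := by
            rw [e3]; simp only [Matrix.mul_assoc]
        _ = _ := Matrix.nonsing_inv_mul_cancel_left _ _ hβd
    have e5 : h * ζ = ζ * h := commute_of_regSemisimple _ hrss h ζ e4 hnormal.symm
    refine ⟨h, ⟨hh, hhU⟩, e5, ?_, rfl⟩
    apply hζ.mul_right_cancel
    rw [e5, e1]
  · rintro ⟨k, ⟨hk, hkU⟩, hc, rfl, rfl⟩
    refine ⟨⟨hk, hkU⟩, ⟨hk, hkU⟩, ?_⟩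
    rw [Matrix.mul_assoc, ← hc, Matrix.nonsing_inv_mul_cancel_left]
    exact (Matrix.isUnit_iff_isUnit_det _).1 hk
end

section
/- Let β ∈ GL_n(E) be skew-Hermitian and let A' ∈ GL_n(E) be regular semisimple with (A')* = βA'β⁻¹. Suppose A' is the norm of some element of GL_n(E), i.e. there exist h, γ ∈ GL_n(E) with h⁻¹A'h = σ(γ)γ. Then there exists ζ ∈ GL_n(E) such that A' = β⁻¹ζ*βζ. -/
/-!
STATEMENT 6: If A' is regular semisimple, β-Hermitian-twisted ((A')* = βA'β⁻¹),
and is (conjugate to) a norm from GL_n(E), then A' = β⁻¹ζ*βζ for some ζ ∈ GL_n(E).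
-/

open Matrix

open Polynomial in
theorem aux_aeval_semiconj {n : ℕ} {E : Type*} [Field E] (M N P : Matrix (Fin n) (Fin n) E)
    (h : M * P = P * N) (p : E[X]) : aeval M p * P = P * aeval N p := by
  induction p using Polynomial.induction_on' with
  | add p q hp hq => simp only [map_add, add_mul, mul_add, hp, hq]
  | monomial k a =>
    have hk : M ^ k * P = P * N ^ k := by
      induction k with
      | zero => simp
      | succ k ih => rw [pow_succ, mul_assoc, h, ← mul_assoc, ih, mul_assoc, ← pow_succ]
    simp only [aeval_monomial, Algebra.algebraMap_eq_smul_one]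
    simp only [smul_mul_assoc, one_mul, mul_smul_comm, hk]

open Polynomial in
theorem aux_aeval_map {n : ℕ} {E : Type*} [Field E] (s : E →+* E) (M : Matrix (Fin n) (Fin n) E)
    (p : E[X]) : (aeval M p).map s = aeval (M.map s) (p.map s) := by
  change s.mapMatrix (aeval M p) = aeval (s.mapMatrix M) (p.map s)
  induction p using Polynomial.induction_on' with
  | add p q hp hq => simp only [map_add, Polynomial.map_add, hp, hq]
  | monomial k a =>
    simp only [aeval_monomial, Polynomial.map_monomial, map_mul, map_pow]
    congr 1
    ext i j
    simp [Matrix.algebraMap_matrix_apply, apply_ite s]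

open Polynomial in
theorem aux_aeval_transpose {n : ℕ} {E : Type*} [Field E] (M : Matrix (Fin n) (Fin n) E)
    (p : E[X]) : (aeval M p)ᵀ = aeval Mᵀ p := by
  induction p using Polynomial.induction_on' with
  | add p q hp hq => simp only [map_add, Matrix.transpose_add, hp, hq]
  | monomial k a =>
    simp [aeval_monomial, Algebra.algebraMap_eq_smul_one, Matrix.transpose_pow]

open Polynomial in
theorem aux_degree {n : ℕ} {E : Type*} [Field E] (A : Matrix (Fin n) (Fin n) E)
    (hA : IsRegSemisimple A) (p : E[X]) (hp : p ≠ 0) (h0 : aeval A p = 0) : n ≤ p.natDegree := by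
  obtain ⟨hc, hnd⟩ := hA
  set f := algebraMap E (AlgebraicClosure E) with hf
  have hpm : p.map f ≠ 0 := (Polynomial.map_ne_zero_iff f.injective).2 hp
  have hle : (A.charpoly.map f).roots ≤ (p.map f).roots := by
    rw [Multiset.le_iff_subset hnd]
    intro μ hμ
    rw [mem_roots hpm]
    have hμ' := isRoot_of_mem_roots hμ
    rw [← Matrix.charpoly_map] at hμ'
    rw [IsRoot, Matrix.eval_charpoly] at hμ'
    obtain ⟨w, hw0, hw⟩ := Matrix.exists_mulVec_eq_zero_iff.2 hμ'
    have hw1 : (A.map f) *ᵥ w = μ • w := by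
      rw [Matrix.sub_mulVec, sub_eq_zero] at hw
      rw [← hw]
      simp [Matrix.scalar_apply, ← Matrix.smul_one_eq_diagonal, Matrix.smul_mulVec]
    have key : ∀ q : E[X], ((aeval A q).map f) *ᵥ w = (q.map f).eval μ • w := by
      intro q
      change (f.mapMatrix (aeval A q)) *ᵥ w = (q.map f).eval μ • w
      induction q using Polynomial.induction_on' with
      | add p q hp hq =>
        rw [map_add, map_add, Matrix.add_mulVec, hp, hq, Polynomial.map_add, eval_add, add_smul]
      | monomial k a =>
        have hk : (A.map f) ^ k *ᵥ w = μ ^ k • w := by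
          induction k with
          | zero => simp
          | succ k ih =>
            rw [pow_succ, ← Matrix.mulVec_mulVec, hw1, Matrix.mulVec_smul, ih, smul_smul,
              ← pow_succ']
        have h2 : f.mapMatrix (aeval A (monomial k a)) = f a • (A.map f) ^ k := by
          rw [aeval_monomial, map_mul, map_pow, Algebra.algebraMap_eq_smul_one, smul_eq_diagonal_mul]
          rw [smul_eq_diagonal_mul]
          congr 1
          ext i j
          simp [Matrix.diagonal_apply, apply_ite f]
        rw [h2, Matrix.smul_mulVec, hk, smul_smul]
        simp
    have h3 := key p
    rw [h0] at h3
    have h4 : (0 : Matrix (Fin n) (Fin n) E).map f = 0 := by ext; simp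
    rw [h4, Matrix.zero_mulVec] at h3
    exact (smul_eq_zero.1 h3.symm).resolve_right hw0
  calc n = _ := hc.symm
    _ ≤ _ := Multiset.card_le_card hle
    _ ≤ _ := card_roots' _
    _ = _ := natDegree_map f

open Polynomial in
theorem aux_cyclic {n : ℕ} {E : Type*} [Field E] (A : Matrix (Fin n) (Fin n) E) :
    ∃ v : Fin n → E, ∀ p : E[X], aeval A p *ᵥ v = 0 → aeval A p = 0 := by
  let φ : Module.End E (Fin n → E) := Matrix.toLinAlgEquiv' A
  have hφ : ∀ p : E[X], aeval φ p = Matrix.toLinAlgEquiv' (aeval A p) := fun p =>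
    aeval_algHom_apply (Matrix.toLinAlgEquiv' : Matrix (Fin n) (Fin n) E ≃ₐ[E] _).toAlgHom A p
  have htor : Module.IsTorsion E[X] (Module.AEval' φ) := by
    exact Module.AEval.isTorsion_of_finiteDimensional E _ φ
  obtain ⟨x, hx⟩ := Module.exists_ker_toSpanSingleton_eq_annihilator E[X] (Module.AEval' φ)
  refine ⟨(Module.AEval'.of φ).symm x, fun p hp => ?_⟩
  have h1 : p ∈ Module.annihilator E[X] (Module.AEval' φ) := by
    rw [← hx, LinearMap.mem_ker, LinearMap.toSpanSingleton_apply]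
    apply (Module.AEval'.of φ).symm.injective
    rw [map_zero]
    refine (Module.AEval.of_symm_smul φ p x).trans ?_
    rw [hφ]
    exact hp
  rw [← Polynomial.span_minpoly_eq_annihilator, Ideal.mem_span_singleton, minpoly.dvd_iff] at h1
  rw [hφ] at h1
  exact (map_eq_zero_iff _ (AlgEquiv.injective _)).1 h1

open Polynomial in
theorem aux_main_ring {R : Type*} [Ring R] (s : R →+* R) (hs : ∀ x, s (s x) = x)
    (A C : R) (P h γ : Rˣ) (hC : A * P = P * C) (hsC : s C = C)
    (hN : (↑h⁻¹ : R) * A * h = s γ * γ) :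
    ∃ δ : R, C = s δ * δ ∧ Commute (P * δ * (↑P⁻¹ : R)) A := by
  let k : Rˣ := h⁻¹ * P
  let sk : Rˣ := Units.map s.toMonoidHom k
  have hsk : (sk : R) = s k := rfl
  have hski : ((sk⁻¹ : Rˣ) : R) = s (k⁻¹ : Rˣ) := rfl
  have e1 : C = (↑k⁻¹ : R) * (s γ * γ) * k := by
    have : C = (↑P⁻¹ : R) * (A * P) := by rw [hC]; simp
    rw [← hN, this]
    simp [k, mul_assoc]
  have e2 : C = s (s (k⁻¹ : Rˣ) * γ * k) * (s (k⁻¹ : Rˣ) * γ * k) := by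
    rw [e1]
    simp only [map_mul, hs]
    have : s k * s (k⁻¹ : Rˣ) = 1 := by rw [← map_mul]; simp
    simp only [mul_assoc]
    rw [← mul_assoc (s k), this, one_mul]
  refine ⟨s (k⁻¹ : Rˣ) * γ * k, e2, ?_⟩
  generalize s (k⁻¹ : Rˣ) * γ * k = δ at e2
  have e3 : C = δ * s δ := by
    rw [← hsC, e2, map_mul, hs]
  have e4 : δ * C = C * δ := by
    nth_rewrite 1 [e2]
    rw [← mul_assoc, ← e3]
  have hA : A = P * C * (↑P⁻¹ : R) := by rw [← hC]; simp
  rw [hA, commute_iff_eq]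
  simp only [mul_assoc, Units.inv_mul_cancel_left]
  rw [← mul_assoc δ, e4, mul_assoc]

open Polynomial in
theorem aux_krylov {n : ℕ} {E : Type*} [Field E] (A : Matrix (Fin n) (Fin n) E) (v w : Fin n → E) :
    (Matrix.of fun i (j : Fin n) => (A ^ (j : ℕ) *ᵥ v) i) *ᵥ w =
      aeval A (∑ j : Fin n, C (w j) * X ^ (j : ℕ)) *ᵥ v := by
  simp only [map_sum, map_mul, aeval_C, map_pow, aeval_X, Matrix.sum_mulVec,
    Algebra.algebraMap_eq_smul_one, smul_mul_assoc, one_mul, Matrix.smul_mulVec]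
  ext i
  simp [Matrix.mulVec, dotProduct, Finset.sum_apply, mul_comm]

open Polynomial in
theorem aux_krylov_isUnit {n : ℕ} {E : Type*} [Field E] (A : Matrix (Fin n) (Fin n) E)
    (hA : IsRegSemisimple A) (v : Fin n → E)
    (hv : ∀ p : E[X], aeval A p *ᵥ v = 0 → aeval A p = 0) :
    IsUnit (Matrix.of fun i (j : Fin n) => (A ^ (j : ℕ) *ᵥ v) i) := by
  rw [← Matrix.mulVec_injective_iff_isUnit]
  rw [← Matrix.coe_mulVecLin, ← LinearMap.ker_eq_bot, LinearMap.ker_eq_bot']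
  intro w hw
  rw [Matrix.mulVecLin_apply, aux_krylov] at hw
  have h0 := hv _ hw
  have hz : (∑ j : Fin n, C (w j) * X ^ (j : ℕ)) = 0 := by
    by_contra hne
    have h1 := aux_degree A hA _ hne h0
    have h2 := Polynomial.degree_sum_fin_lt w
    rw [degree_eq_natDegree hne] at h2
    exact absurd (Nat.cast_lt.1 h2) (not_lt.2 h1)
  ext j
  have := congrArg (fun q => q.coeff (j : ℕ)) hz
  simpa [finsetSum_coeff, coeff_X_pow, Fin.val_inj] using this

open Polynomial in
theorem aux_companion {n : ℕ} {E : Type*} [Field E] (A : Matrix (Fin n) (Fin n) E)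
    (v : Fin n → E) :
    A * (Matrix.of fun i (j : Fin n) => (A ^ (j : ℕ) *ᵥ v) i) =
    (Matrix.of fun i (j : Fin n) => (A ^ (j : ℕ) *ᵥ v) i) *
    (Matrix.of fun i j : Fin n => if (j : ℕ) + 1 = n then - A.charpoly.coeff i else
      if (i : ℕ) = j + 1 then (1 : E) else 0) := by
  ext i j
  have hL : (A * (Matrix.of fun i (j : Fin n) => (A ^ (j : ℕ) *ᵥ v) i)) i j =
      (A ^ ((j : ℕ) + 1) *ᵥ v) i := by
    rw [pow_succ', ← Matrix.mulVec_mulVec]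
    rfl
  have hR : ∀ c : Fin n → Fin n → E,
      ((Matrix.of fun i (j : Fin n) => (A ^ (j : ℕ) *ᵥ v) i) * Matrix.of c) i j =
      (aeval A (∑ k : Fin n, C (c k j) * X ^ (k : ℕ)) *ᵥ v) i := by
    intro c
    rw [← aux_krylov]
    rfl
  rw [hL, hR]
  congr 2
  by_cases hj : (j : ℕ) + 1 = n
  · simp only [hj, if_true]
    have hch := Matrix.aeval_self_charpoly A
    have hmon := Matrix.charpoly_monic A
    have hd : A.charpoly.natDegree = n := by simp
    rw [hmon.as_sum, hd, ← Fin.sum_univ_eq_sum_range (fun k => C (A.charpoly.coeff k) * X ^ k) n,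
      map_add] at hch
    simp only [map_neg, neg_mul, Finset.sum_neg_distrib]
    rw [← eq_neg_iff_add_eq_zero.2 hch]
    simp
  · have hlt : (j : ℕ) + 1 < n := by omega
    simp only [hj, if_false]
    rw [Finset.sum_eq_single (⟨(j : ℕ) + 1, hlt⟩ : Fin n)]
    · simp
    · intro b _ hb
      have : (b : ℕ) ≠ j + 1 := fun h => hb (Fin.ext h)
      simp [this]
    · simp

theorem hermitian_regular_semisimple_norm_is_twisted_norm
    {F E : Type*} [Field F] [Field E] [Algebra F E]
    (σ : E ≃ₐ[F] E)
    (hσ2 : ∀ x : E, σ (σ x) = x)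
    (hfix : ∀ x : E, σ x = x ↔ x ∈ Set.range (algebraMap F E))
    (hdeg : Module.finrank F E = 2)
    (n : ℕ) (hn : 1 ≤ n)
    (β : Matrix (Fin n) (Fin n) E) (hβ : IsUnit β)
    (hskew : (β.map ⇑σ)ᵀ = -β)
    (A' : Matrix (Fin n) (Fin n) E) (hA' : IsUnit A')
    (hrss : IsRegSemisimple A')
    (hherm : (A'.map ⇑σ)ᵀ = β * A' * β⁻¹)
    (hnorm : ∃ h γ : Matrix (Fin n) (Fin n) E, IsUnit h ∧ IsUnit γ ∧
      h⁻¹ * A' * h = (γ.map ⇑σ) * γ) :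
    ∃ ζ : Matrix (Fin n) (Fin n) E, IsUnit ζ ∧ A' = β⁻¹ * (ζ.map ⇑σ)ᵀ * β * ζ := by
  obtain ⟨h, γ, hh, hγ, hN⟩ := hnorm
  let s : E →+* E := (σ : E →+* E)
  have hs : ∀ M : Matrix (Fin n) (Fin n) E, M.map ⇑σ = M.map s := fun _ => rfl
  have hβdet : IsUnit β.det := (Matrix.isUnit_iff_isUnit_det β).1 hβ
  have hch : A'.charpoly.map s = A'.charpoly := by
    rw [← Matrix.charpoly_map, ← Matrix.charpoly_transpose]
    change ((A'.map ⇑σ)ᵀ).charpoly = _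
    rw [hherm]
    obtain ⟨b, rfl⟩ := hβ
    exact Matrix.charpoly_units_conj b A'
  have hco : ∀ i, σ (A'.charpoly.coeff i) = A'.charpoly.coeff i := by
    intro i
    conv_rhs => rw [← hch, Polynomial.coeff_map]
    rfl
  obtain ⟨v, hv⟩ := aux_cyclic A'
  obtain ⟨P, hP⟩ := aux_krylov_isUnit A' hrss v hv
  have hcomp := aux_companion A' v
  rw [← hP] at hcomp
  set C : Matrix (Fin n) (Fin n) E :=
    (Matrix.of fun i j : Fin n => if (j : ℕ) + 1 = n then - A'.charpoly.coeff i else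
      if (i : ℕ) = j + 1 then (1 : E) else 0) with hCdef
  have hsC : s.mapMatrix C = C := by
    ext i j
    change σ (C i j) = C i j
    simp only [hCdef, Matrix.of_apply]
    split_ifs <;> simp [hco]
  obtain ⟨h, rfl⟩ := hh
  obtain ⟨γ, rfl⟩ := hγ
  rw [← Matrix.coe_units_inv] at hN
  obtain ⟨δ, hδ, hcomm⟩ := aux_main_ring s.mapMatrix
    (fun M => by ext i j; exact hσ2 (M i j)) A' C P h γ hcomp hsC hN
  obtain ⟨p, hp⟩ : ∃ p : Polynomial E, Polynomial.aeval A' p =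
      (P : Matrix (Fin n) (Fin n) E) * δ * (↑P⁻¹ : Matrix (Fin n) (Fin n) E) := by
    set D := (P : Matrix (Fin n) (Fin n) E) * δ * (↑P⁻¹ : Matrix (Fin n) (Fin n) E) with hD
    refine ⟨∑ j : Fin n, Polynomial.C (((↑P⁻¹ : Matrix (Fin n) (Fin n) E) *ᵥ (D *ᵥ v)) j) *
      Polynomial.X ^ (j : ℕ), ?_⟩
    have h1 := aux_krylov A' v ((↑P⁻¹ : Matrix (Fin n) (Fin n) E) *ᵥ (D *ᵥ v))
    rw [← hP, Matrix.mulVec_mulVec, Units.mul_inv, Matrix.one_mulVec] at h1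
    generalize (∑ j : Fin n, Polynomial.C (((↑P⁻¹ : Matrix (Fin n) (Fin n) E) *ᵥ (D *ᵥ v)) j) *
      Polynomial.X ^ (j : ℕ)) = p at h1
    have h2 : Polynomial.aeval A' p * (P : Matrix (Fin n) (Fin n) E) = D * P := by
      rw [hP]
      ext i j
      have h3 : ∀ M : Matrix (Fin n) (Fin n) E, Commute M A' →
          (M * Matrix.of fun i (j : Fin n) => (A' ^ (j : ℕ) *ᵥ v) i) i j =
          (A' ^ (j : ℕ) *ᵥ (M *ᵥ v)) i := by
        intro M hM
        rw [Matrix.mulVec_mulVec, ← (hM.pow_right (j : ℕ)).eq, ← Matrix.mulVec_mulVec]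
        rfl
      rw [h3 _ hcomm, h3 _ (aux_aeval_semiconj A' A' A' rfl p), h1]
    exact P.isUnit.mul_right_cancel h2
  have hδp : δ = Polynomial.aeval C p := by
    have h1 := aux_aeval_semiconj A' C P hcomp p
    rw [hp] at h1
    have h2 : (P : Matrix (Fin n) (Fin n) E) * δ = P * Polynomial.aeval C p := by
      rw [← h1]; simp [mul_assoc]
    exact P.isUnit.mul_left_cancel h2
  have hsδ : s.mapMatrix δ = Polynomial.aeval C (p.map s) := by
    have h1 := aux_aeval_map s C p
    rw [← hδp] at h1
    rw [show C.map s = C from hsC] at h1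
    exact h1
  have hA : A' = Polynomial.aeval A' (p.map s) * Polynomial.aeval A' p := by
    have h1 := aux_aeval_semiconj A' C P hcomp (p.map s * p)
    rw [map_mul, map_mul, ← hsδ, ← hδp, ← hδ, ← hcomp] at h1
    exact (P.isUnit.mul_right_cancel h1).symm
  have hζ : ((Polynomial.aeval A' p).map ⇑σ)ᵀ * β = β * Polynomial.aeval A' (p.map s) := by
    rw [hs, aux_aeval_map, aux_aeval_transpose]
    apply aux_aeval_semiconj
    rw [← hs, hherm, mul_assoc, Matrix.nonsing_inv_mul β hβdet, mul_one]
  refine ⟨Polynomial.aeval A' p, ?_, ?_⟩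
  · rw [hA] at hA'
    exact isUnit_of_mul_isUnit_right hA'
  · rw [mul_assoc β⁻¹, hζ, ← mul_assoc, Matrix.nonsing_inv_mul β hβdet, one_mul]
    exact hA
end

section
/- Let β ∈ GL_n(E) be skew-Hermitian, and let S ⊆ GL_n(E) be a set of normal elements containing exactly one element of each σ-conjugacy class whose norm σ(γ)γ is regular semisimple. Then there exists a set R ⊆ GL_n(E) such that: (i) every ζ ∈ R is normal with respect to β and β⁻¹ζ*βζ is regular semisimple and equals σ(γ₀)γ₀ for some γ₀ ∈ GL_n(E); (ii) R contains exactly one element of each double orbit {g⁻¹ζ'h : g, h ∈ U_n^β(F)} for which β⁻¹ζ'*βζ' is regular semisimple and equals σ(γ₀)γ₀ for some γ₀ ∈ GL_n(E); and (iii) R is compatible with S, meaning that for all γ ∈ S, ζ ∈ R and h ∈ GL_n(E) with β⁻¹ζ*βζ = h⁻¹(σ(γ)γ)h, one has ζ = h⁻¹γh. -/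
/-!
STATEMENT 7: For every set S of normal representatives of the regular semisimple
σ-conjugacy classes, and every skew-Hermitian β, there exists a set R of
representatives on the unitary side which is compatible with S.
-/

open Matrix

section Aux
open Polynomial

lemma aux_exists_sep {K V : Type*} [Field K] [AddCommGroup V] [Module K V] [Module.Finite K V]
    (f : V →ₗ[K] V) : ∃ v : V, ∀ p : K[X], aeval f p v = 0 → aeval f p = 0 := by
  obtain ⟨x, hx⟩ := Module.exists_ker_toSpanSingleton_eq_annihilator K[X] (Module.AEval' f)
  refine ⟨(Module.AEval'.of f).symm x, fun p hp => ?_⟩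
  have h1 : p ∈ LinearMap.ker (LinearMap.toSpanSingleton K[X] (Module.AEval' f) x) := by
    rw [LinearMap.mem_ker, LinearMap.toSpanSingleton_apply]
    apply (Module.AEval'.of f).symm.injective
    rw [map_zero]
    exact hp
  rw [hx, Module.mem_annihilator] at h1
  ext v
  have := h1 (Module.AEval'.of f v)
  exact this

lemma aux_min {n : ℕ} {E : Type*} [Field E] {A : Matrix (Fin n) (Fin n) E}
    (hA : IsRegSemisimple A) (p : E[X]) (hp : aeval A p = 0) (hd : p.degree < n) : p = 0 := by
  by_contra h0
  set φ := algebraMap E (AlgebraicClosure E) with hφ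
  have hp' : aeval (A.map φ) (p.map φ) = 0 := by
    have h := congrArg (fun M : Matrix (Fin n) (Fin n) E => φ.mapMatrix M) hp
    simp only [map_zero] at h
    rw [← h, aeval_def, aeval_def, hom_eval₂, eval₂_map]
    congr 1
    ext x i j
    by_cases hij : i = j <;> simp [Matrix.algebraMap_matrix_apply, hij, hφ]
  have hsub : (A.charpoly.map φ).roots ≤ (p.map φ).roots := by
    rw [Multiset.le_iff_subset hA.2]
    intro μ hμ
    rw [mem_roots', ← Matrix.charpoly_map, ← Matrix.mem_spectrum_iff_isRoot_charpoly] at hμ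
    have := spectrum.subset_polynomial_aeval (A.map φ) (p.map φ) ⟨μ, hμ.2, rfl⟩
    rw [hp'] at this
    rw [mem_roots (Polynomial.map_ne_zero h0)]
    by_contra hne
    apply this
    rw [spectrum.mem_resolventSet_iff, sub_zero]
    exact (IsUnit.mk0 _ hne).map (algebraMap _ _)
  have h1 := Multiset.card_le_card hsub
  rw [hA.1] at h1
  have h2 := h1.trans (card_roots' _)
  rw [natDegree_map] at h2
  rw [degree_eq_natDegree h0] at hd
  exact absurd (Nat.cast_lt.mp hd) (not_lt.mpr h2)

lemma aux_comm {K R : Type*} [CommSemiring K] [Semiring R] [Algebra K R] {A M : R}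
    (h : M * A = A * M) (q : K[X]) : M * aeval A q = aeval A q * M := by
  induction q using Polynomial.induction_on' with
  | add p q hp hq => simp only [map_add, mul_add, add_mul, hp, hq]
  | monomial k a =>
    have h1 : Commute M (A ^ k) := Commute.pow_right h k
    rw [aeval_monomial, ← mul_assoc, ← Algebra.commutes, mul_assoc, h1.eq, mul_assoc]

lemma aux_central {n : ℕ} {E : Type*} [Field E] {A : Matrix (Fin n) (Fin n) E}
    (hA : IsRegSemisimple A) (M : Matrix (Fin n) (Fin n) E) (hM : M * A = A * M) :
    ∃ p : E[X], M = aeval A p := by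
  obtain ⟨v, hv⟩ := aux_exists_sep (Matrix.toLin' A)
  have hae : ∀ p : E[X], aeval (Matrix.toLin' A) p = Matrix.toLin' (aeval A p) := fun p =>
    aeval_algHom_apply (Matrix.toLinAlgEquiv' : Matrix (Fin n) (Fin n) E ≃ₐ[E] _).toAlgHom A p
  let T : degreeLT E n →ₗ[E] (Fin n → E) :=
    { toFun := fun p => aeval A (p : E[X]) *ᵥ v
      map_add' := fun p q => by simp [Matrix.add_mulVec]
      map_smul' := fun c p => by simp [Matrix.smul_mulVec] }
  have hinj : Function.Injective T := by
    rw [← LinearMap.ker_eq_bot, LinearMap.ker_eq_bot']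
    rintro ⟨p, hp⟩ h
    have h1 := hv p (by rw [hae, Matrix.toLin'_apply]; exact h)
    rw [hae] at h1
    have h2 := aux_min hA p (by simpa using h1) (mem_degreeLT.mp hp)
    exact Subtype.ext h2
  have hsur : Function.Surjective T := by
    have : Function.Surjective (T ∘ₗ (degreeLTEquiv E n).symm.toLinearMap) := by
      rw [← LinearMap.injective_iff_surjective]
      exact hinj.comp (degreeLTEquiv E n).symm.injective
    exact fun y => (this y).imp' (degreeLTEquiv E n).symm (fun _ h => h)
  obtain ⟨p, hp⟩ := hsur (M *ᵥ v)
  change aeval A (p : E[X]) *ᵥ v = M *ᵥ v at hp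
  refine ⟨p, ?_⟩
  apply Matrix.mulVec_injective
  funext w
  obtain ⟨q, rfl⟩ := hsur w
  change M *ᵥ (aeval A (q : E[X]) *ᵥ v) = aeval A (p : E[X]) *ᵥ (aeval A (q : E[X]) *ᵥ v)
  rw [Matrix.mulVec_mulVec, aux_comm hM, ← Matrix.mulVec_mulVec, ← hp, Matrix.mulVec_mulVec,
    Matrix.mulVec_mulVec, ← map_mul, mul_comm, map_mul]

lemma aux_smap {n : ℕ} {F E : Type*} [Field F] [Field E] [Algebra F E] (σ : E ≃ₐ[F] E)
    {B : Matrix (Fin n) (Fin n) E} (p : E[X]) :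
    (aeval B p).map ⇑σ = aeval (B.map ⇑σ) (p.map (σ : E →+* E)) := by
  change (σ : E →+* E).mapMatrix (aeval B p) = aeval ((σ : E →+* E).mapMatrix B) _
  rw [aeval_def, aeval_def, hom_eval₂, eval₂_map]
  congr 1
  ext x i j
  by_cases hij : i = j <;> simp [Matrix.algebraMap_matrix_apply, hij]

lemma aux_descent {n : ℕ} {F E : Type*} [Field F] [Field E] [Algebra F E] (σ : E ≃ₐ[F] E)
    (hσ2 : ∀ x : E, σ (σ x) = x)
    (hfix : ∀ x : E, σ x = x ↔ x ∈ Set.range (algebraMap F E))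
    (hdeg : Module.finrank F E = 2)
    {A B γ γ₁ k : Matrix (Fin n) (Fin n) E} (hB : IsRegSemisimple B)
    (hAs : A.map ⇑σ = A) (hBs : B.map ⇑σ = B) (hγ : IsUnit γ) (hγ₁ : IsUnit γ₁) (hk : IsUnit k)
    (hA : γ.map ⇑σ * γ = A) (hA' : γ * γ.map ⇑σ = A)
    (hB1 : γ₁.map ⇑σ * γ₁ = B) (hB' : γ₁ * γ₁.map ⇑σ = B)
    (hkk : A * k = k * B) :
    ∃ X : Matrix (Fin n) (Fin n) E, IsUnit X ∧ γ * X.map ⇑σ = X * γ₁ := by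
  have hfin : Module.Finite F E := Module.finite_of_finrank_pos (by omega)
  have hss : ∀ M : Matrix (Fin n) (Fin n) E, (M.map ⇑σ).map ⇑σ = M := fun M => by
    ext i j; simp [hσ2]
  have hmm : ∀ M N : Matrix (Fin n) (Fin n) E, (M * N).map ⇑σ = M.map ⇑σ * N.map ⇑σ := fun M N =>
    Matrix.map_mul (f := σ)
  have hma : ∀ M N : Matrix (Fin n) (Fin n) E, (M + N).map ⇑σ = M.map ⇑σ + N.map ⇑σ := fun M N =>
    Matrix.map_add _ (map_add σ) M N
  have hγB : γ₁ * B = B * γ₁ := by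
    conv_lhs => rw [← hB1]
    rw [← hB', mul_assoc]
  have hγA : γ * A = A * γ := by
    conv_lhs => rw [← hA]
    rw [← hA', mul_assoc]
  obtain ⟨lam, hlam⟩ : ∃ x : E, σ x ≠ x := by
    by_contra! h
    have hsur : Function.Surjective (Algebra.linearMap F E) := fun x => (hfix x).1 (h x)
    have := (Algebra.linearMap F E).finrank_range_le
    rw [LinearMap.range_eq_top.2 hsur, finrank_top, hdeg, Module.finrank_self] at this
    omega
  -- the F-form of the space of intertwiners
  let W : Submodule F (Matrix (Fin n) (Fin n) E) :=
    { carrier := {X | A * X = X * B ∧ γ * X.map ⇑σ = X * γ₁}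
      add_mem' := by
        rintro X Y ⟨h1, h2⟩ ⟨h3, h4⟩
        refine ⟨by rw [mul_add, add_mul, h1, h3], by rw [hma, mul_add, add_mul, h2, h4]⟩
      zero_mem' := by
        refine ⟨by simp, by simp [Matrix.map_zero]⟩
      smul_mem' := by
        rintro c X ⟨h1, h2⟩
        refine ⟨by rw [mul_smul_comm, smul_mul_assoc, h1], ?_⟩
        have : (c • X).map ⇑σ = c • X.map ⇑σ := by ext i j; simp
        rw [this, mul_smul_comm, smul_mul_assoc, h2] }
  have hWf : ∀ X ∈ W, (LinearMap.mulRight F B) X ∈ W := by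
    rintro X ⟨h1, h2⟩
    refine ⟨?_, ?_⟩
    · simp only [LinearMap.mulRight_apply]
      rw [← mul_assoc, h1]
    · simp only [LinearMap.mulRight_apply]
      rw [hmm, hBs, ← mul_assoc, h2, mul_assoc, hγB, mul_assoc]
  let f : W →ₗ[F] W := (LinearMap.mulRight F B).restrict hWf
  have hf : ∀ (p : F[X]) (X : W), ((aeval f p X : W) : Matrix (Fin n) (Fin n) E)
      = (X : Matrix (Fin n) (Fin n) E) * aeval B p := by
    intro p
    induction p using Polynomial.induction_on' with
    | add p q hp hq => intro X; simp [hp, hq, mul_add]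
    | monomial m a =>
      intro X
      have : ∀ X : W, (((f ^ m) X : W) : Matrix (Fin n) (Fin n) E) = X * B ^ m := by
        induction m with
        | zero => intro X; simp
        | succ m ih =>
          intro X
          rw [pow_succ', Module.End.mul_apply, pow_succ, ← mul_assoc, ← ih]
          rfl
      rw [aeval_monomial, aeval_monomial, Module.End.mul_apply, Module.algebraMap_end_apply,
        Submodule.coe_smul, this, ← Algebra.smul_def, mul_smul_comm]
  obtain ⟨⟨X, hXA, hXg⟩, hX⟩ := aux_exists_sep f
  have hg1 : γ₁ * γ₁⁻¹ = 1 := Matrix.mul_nonsing_inv _ ((Matrix.isUnit_iff_isUnit_det _).1 hγ₁)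
  have hg2 : γ₁⁻¹ * γ₁ = 1 := Matrix.nonsing_inv_mul _ ((Matrix.isUnit_iff_isUnit_det _).1 hγ₁)
  have hsk : A * k.map ⇑σ = k.map ⇑σ * B := by
    conv_lhs => rw [← hAs]
    rw [← hmm, hkk, hmm, hBs]
  have hBinv : B * γ₁⁻¹ = γ₁⁻¹ * B := by
    calc B * γ₁⁻¹ = γ₁⁻¹ * (γ₁ * B) * γ₁⁻¹ := by rw [← mul_assoc, hg2, one_mul]
      _ = γ₁⁻¹ * B := by rw [hγB, mul_assoc, mul_assoc, hg1, mul_one]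
  -- membership of averages
  have hav : ∀ c : E, c • k + σ c • (γ * k.map ⇑σ * γ₁⁻¹) ∈ W := by
    intro c
    refine ⟨?_, ?_⟩
    · rw [mul_add, add_mul, mul_smul_comm, smul_mul_assoc, mul_smul_comm, smul_mul_assoc, hkk]
      congr 2
      rw [← mul_assoc, ← mul_assoc, ← hγA, mul_assoc γ, hsk, mul_assoc _ γ₁⁻¹, ← hBinv]
      simp only [mul_assoc]
    · have hsm : ∀ (d : E) (M : Matrix (Fin n) (Fin n) E),
          (d • M).map ⇑σ = σ d • M.map ⇑σ := fun d M => by ext i j; simp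
      have hginv : (γ₁⁻¹).map ⇑σ = B⁻¹ * γ₁ := by
        have hBu : IsUnit B.det := by
          rw [← Matrix.isUnit_iff_isUnit_det, ← hB']
          exact hγ₁.mul (hγ₁.map (σ : E →+* E).mapMatrix)
        have h1 : B * (γ₁⁻¹).map ⇑σ = γ₁ := by
          rw [← hB', mul_assoc, ← hmm, hg1, Matrix.map_one _ (map_zero σ) (map_one σ), mul_one]
        calc (γ₁⁻¹).map ⇑σ = B⁻¹ * (B * (γ₁⁻¹).map ⇑σ) := by
              rw [← mul_assoc, Matrix.nonsing_inv_mul _ hBu, one_mul]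
          _ = B⁻¹ * γ₁ := by rw [h1]
      have h2 : γ * (γ * k.map ⇑σ * γ₁⁻¹).map ⇑σ = k * γ₁ := by
        have hBu : IsUnit B.det := by
          rw [← Matrix.isUnit_iff_isUnit_det, ← hB']
          exact hγ₁.mul (hγ₁.map (σ : E →+* E).mapMatrix)
        rw [hmm, hmm, hss, hginv, ← mul_assoc, ← mul_assoc, ← mul_assoc, hA', hkk, mul_assoc k,
          Matrix.mul_nonsing_inv _ hBu, mul_one]
      rw [hma, hsm, hsm, hσ2, mul_add, mul_smul_comm, mul_smul_comm, h2, add_mul, smul_mul_assoc,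
        smul_mul_assoc, mul_assoc _ γ₁⁻¹, hg2, mul_one, add_comm]
  -- F-polynomials annihilating X annihilate B
  have hann : ∀ p : F[X], X * aeval B p = 0 → aeval B p = 0 := by
    intro p hp
    have h0 : aeval f p = 0 := hX p (Subtype.ext (by rw [hf]; exact hp))
    have hall : ∀ Y ∈ W, Y * aeval B p = 0 := fun Y hY => by
      rw [← hf p ⟨Y, hY⟩, h0]; rfl
    have e1 := hall _ (hav 1)
    have e2 := hall _ (hav lam)
    set P := aeval B p
    set K := γ * k.map ⇑σ * γ₁⁻¹
    have e3 : (σ lam - lam) • (k * P) = 0 := by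
      have : (σ lam - lam) • (k * P) = σ lam • (((1:E) • k + σ 1 • K) * P)
          - (lam • k + σ lam • K) * P := by
        rw [map_one, one_smul, one_smul, add_mul, add_mul, smul_add, smul_mul_assoc,
          smul_mul_assoc, sub_smul]
        abel
      rw [this, e1, e2, smul_zero, sub_zero]
    have e4 := (smul_eq_zero.1 e3).resolve_left (sub_ne_zero.2 hlam)
    exact (hk.mul_right_eq_zero).1 e4
  have hsP : ∀ p : E[X], X * aeval B p = 0 → X * aeval B (p.map (σ : E →+* E)) = 0 := by
    intro p hp
    have h1 : γ * (X * aeval B p).map ⇑σ = 0 := by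
      rw [hp]; simp [Matrix.map_zero]
    rw [hmm, aux_smap, hBs, ← mul_assoc, hXg, mul_assoc, aux_comm hγB, ← mul_assoc] at h1
    exact (hγ₁.mul_left_eq_zero).1 h1
  have hXF : ∀ p : E[X], X * aeval B p = 0 → aeval B (p + p.map (σ : E →+* E)) = 0 := by
    intro p hp
    have : p + p.map (σ : E →+* E) ∈ lifts (algebraMap F E) := by
      rw [lifts_iff_coeff_lifts]
      intro m
      rw [← hfix]
      simp [hσ2, add_comm]
    obtain ⟨q, hq⟩ := (mem_lifts _).1 this
    rw [← hq, aeval_map_algebraMap]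
    apply hann
    rw [← aeval_map_algebraMap E, hq, map_add, mul_add, hp, hsP p hp, add_zero]
  have hannE : ∀ p : E[X], X * aeval B p = 0 → aeval B p = 0 := by
    intro p hp
    have e1 := hXF p hp
    have e2 := hXF (C lam * p) (by
      rw [map_mul, aeval_C, ← Algebra.smul_def, mul_smul_comm, hp, smul_zero])
    rw [Polynomial.map_mul, Polynomial.map_C] at e2
    simp only [map_add, map_mul, aeval_C, ← Algebra.smul_def] at e1 e2
    set P := aeval B p
    set Q := aeval B (p.map (σ : E →+* E))
    change lam • P + σ lam • Q = 0 at e2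
    have e3 : (σ lam - lam) • P = σ lam • (P + Q) - (lam • P + σ lam • Q) := by
      rw [smul_add, sub_smul]; abel
    rw [e1, e2, smul_zero, sub_zero] at e3
    exact (smul_eq_zero.1 e3).resolve_left (sub_ne_zero.2 hlam)
  have hk1 : k * k⁻¹ = 1 := Matrix.mul_nonsing_inv _ ((Matrix.isUnit_iff_isUnit_det _).1 hk)
  have hk2 : k⁻¹ * k = 1 := Matrix.nonsing_inv_mul _ ((Matrix.isUnit_iff_isUnit_det _).1 hk)
  have hc : (k⁻¹ * X) * B = B * (k⁻¹ * X) := by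
    calc (k⁻¹ * X) * B = k⁻¹ * (A * X) := by rw [mul_assoc, hXA]
      _ = k⁻¹ * (A * k) * k⁻¹ * X := by simp only [mul_assoc]; rw [← mul_assoc k, hk1, one_mul]
      _ = B * (k⁻¹ * X) := by rw [hkk, ← mul_assoc, hk2, one_mul, mul_assoc]
  obtain ⟨q, hq⟩ := aux_central hB _ hc
  have hXq : X = k * aeval B q := by rw [← hq, ← mul_assoc, hk1, one_mul]
  refine ⟨X, ?_, hXg⟩
  rw [hXq]
  refine hk.mul ?_
  have hmem : ∀ p : E[X], aeval B p ∈ Algebra.adjoin E {B} := fun p =>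
    aeval_mem_adjoin_singleton E B
  have : IsArtinianRing (Algebra.adjoin E {B}) := IsArtinianRing.of_finite E _
  have hnz : (⟨aeval B q, hmem q⟩ : Algebra.adjoin E {B}) ∈ nonZeroDivisors (Algebra.adjoin E {B}) := by
    rw [mem_nonZeroDivisors_iff_right]
    rintro ⟨y, hy⟩ h
    obtain ⟨r, rfl⟩ := (Algebra.adjoin_singleton_eq_range_aeval E B ▸ hy :)
    have h1 : aeval B r * aeval B q = 0 := congrArg Subtype.val h
    have h2 : aeval B r = 0 := by
      apply hannE
      rw [hXq, mul_assoc, ← map_mul, mul_comm, map_mul, h1, mul_zero]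
    exact Subtype.ext h2
  exact (IsArtinianRing.isUnit_of_mem_nonZeroDivisors hnz).map (Algebra.adjoin E {B}).val

lemma aux_inter {K R : Type*} [CommSemiring K] [Semiring R] [Algebra K R] {A B M : R}
    (h : M * A = B * M) (q : K[X]) : M * aeval A q = aeval B q * M := by
  induction q using Polynomial.induction_on' with
  | add p q hp hq => simp only [map_add, mul_add, add_mul, hp, hq]
  | monomial k a =>
    have h1 : M * A ^ k = B ^ k * M := SemiconjBy.pow_right (show SemiconjBy M A B from h) k
    rw [aeval_monomial, aeval_monomial, ← mul_assoc, ← Algebra.commutes, mul_assoc, h1, mul_assoc]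

lemma aux_transpose {n : ℕ} {E : Type*} [Field E] (A : Matrix (Fin n) (Fin n) E) (q : E[X]) :
    (aeval A q)ᵀ = aeval Aᵀ q := by
  induction q using Polynomial.induction_on' with
  | add p q hp hq => simp only [map_add, Matrix.transpose_add, hp, hq]
  | monomial k a =>
    rw [aeval_monomial, aeval_monomial, ← Algebra.smul_def, ← Algebra.smul_def,
      Matrix.transpose_smul, Matrix.transpose_pow]

lemma aux_inv {n : ℕ} {E : Type*} [Field E] {A : Matrix (Fin n) (Fin n) E} (h : IsUnit A) :
    A⁻¹ * A = 1 ∧ A * A⁻¹ = 1 :=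
  ⟨Matrix.nonsing_inv_mul _ ((Matrix.isUnit_iff_isUnit_det _).1 h),
    Matrix.mul_nonsing_inv _ ((Matrix.isUnit_iff_isUnit_det _).1 h)⟩

lemma aux_st_mul {n : ℕ} {F E : Type*} [Field F] [Field E] [Algebra F E] (σ : E ≃ₐ[F] E)
    (M N : Matrix (Fin n) (Fin n) E) :
    ((M * N).map ⇑σ)ᵀ = (N.map ⇑σ)ᵀ * (M.map ⇑σ)ᵀ := by
  rw [Matrix.map_mul (f := σ), Matrix.transpose_mul]

lemma aux_st_one {n : ℕ} {F E : Type*} [Field F] [Field E] [Algebra F E] (σ : E ≃ₐ[F] E) :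
    (((1 : Matrix (Fin n) (Fin n) E)).map ⇑σ)ᵀ = 1 := by
  rw [Matrix.map_one _ (map_zero σ) (map_one σ), Matrix.transpose_one]

lemma aux_exists {F E : Type*} [Field F] [Field E] [Algebra F E]
    (σ : E ≃ₐ[F] E)
    (hσ2 : ∀ x : E, σ (σ x) = x)
    (hfix : ∀ x : E, σ x = x ↔ x ∈ Set.range (algebraMap F E))
    (hdeg : Module.finrank F E = 2)
    (n : ℕ)
    (β : Matrix (Fin n) (Fin n) E) (hβ : IsUnit β)
    (hskew : (β.map ⇑σ)ᵀ = -β)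
    (S : Set (Matrix (Fin n) (Fin n) E))
    (hS1 : ∀ γ ∈ S, IsUnit γ ∧
      (∀ i j, ((γ.map ⇑σ) * γ) i j ∈ Set.range (algebraMap F E)) ∧
      IsRegSemisimple ((γ.map ⇑σ) * γ))
    (hS2 : ∀ δ : Matrix (Fin n) (Fin n) E, IsUnit δ → IsRegSemisimple ((δ.map ⇑σ) * δ) →
      ∃! γ, γ ∈ S ∧ ∃ g : Matrix (Fin n) (Fin n) E, IsUnit g ∧ g⁻¹ * δ * g.map ⇑σ = γ)
    (ζ' : Matrix (Fin n) (Fin n) E)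
    (hreg : IsRegSemisimple (β⁻¹ * (ζ'.map ⇑σ)ᵀ * β * ζ'))
    (hnorm : ∃ γ₀ : Matrix (Fin n) (Fin n) E, IsUnit γ₀ ∧
          β⁻¹ * (ζ'.map ⇑σ)ᵀ * β * ζ' = (γ₀.map ⇑σ) * γ₀) :
    ∃ ζ : Matrix (Fin n) (Fin n) E, IsUnit ζ ∧
      ζ * (β⁻¹ * (ζ.map ⇑σ)ᵀ * β * ζ) = (β⁻¹ * (ζ.map ⇑σ)ᵀ * β * ζ) * ζ ∧
      β⁻¹ * (ζ.map ⇑σ)ᵀ * β * ζ = β⁻¹ * (ζ'.map ⇑σ)ᵀ * β * ζ' ∧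
      (∀ γ ∈ S, ∀ h : Matrix (Fin n) (Fin n) E, IsUnit h →
        β⁻¹ * (ζ.map ⇑σ)ᵀ * β * ζ = h⁻¹ * ((γ.map ⇑σ) * γ) * h →
        ζ = h⁻¹ * γ * h) := by
  have hss : ∀ M : Matrix (Fin n) (Fin n) E, (M.map ⇑σ).map ⇑σ = M := fun M => by
    ext i j; simp [hσ2]
  have hmm : ∀ M N : Matrix (Fin n) (Fin n) E, (M * N).map ⇑σ = M.map ⇑σ * N.map ⇑σ := fun M N =>
    Matrix.map_mul (f := σ)
  have hus : ∀ M : Matrix (Fin n) (Fin n) E, IsUnit M → IsUnit (M.map ⇑σ) := fun M hM =>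
    hM.map (σ : E →+* E).mapMatrix
  obtain ⟨hβ1, hβ2⟩ := aux_inv hβ
  -- facts about normal elements of S
  have hSn : ∀ γ ∈ S, (γ.map ⇑σ * γ).map ⇑σ = γ.map ⇑σ * γ ∧
      γ * γ.map ⇑σ = γ.map ⇑σ * γ := by
    intro γ hγ
    have h1 : (γ.map ⇑σ * γ).map ⇑σ = γ.map ⇑σ * γ := by
      ext i j
      exact (hfix _).2 ((hS1 γ hγ).2.1 i j)
    refine ⟨h1, ?_⟩
    rw [hmm, hss] at h1
    exact h1
  set ν := β⁻¹ * (ζ'.map ⇑σ)ᵀ * β * ζ' with hν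
  have hβν : β * ν = (ζ'.map ⇑σ)ᵀ * β * ζ' := by
    rw [hν]; simp only [← mul_assoc]; rw [hβ2, one_mul]
  have hνst : (ν.map ⇑σ)ᵀ * β = β * ν := by
    have h1 : ((β * ν).map ⇑σ)ᵀ = -(β * ν) := by
      have h0 : (((ζ'.map ⇑σ)ᵀ).map ⇑σ)ᵀ = ζ' := by
        ext i j; simp [hσ2]
      rw [hβν, aux_st_mul, aux_st_mul, hskew, h0]
      simp [mul_assoc]
    rw [aux_st_mul, hskew, mul_neg] at h1
    exact neg_injective h1
  obtain ⟨γ₀, hγ₀, hγ₀ν⟩ := hnorm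
  obtain ⟨γ, ⟨hγS, g, hg, hgγ⟩, -⟩ := hS2 γ₀ hγ₀ (hγ₀ν ▸ hreg)
  obtain ⟨hγu, -, hγr⟩ := hS1 γ hγS
  obtain ⟨hAs, hAc⟩ := hSn γ hγS
  obtain ⟨hg1, hg2⟩ := aux_inv hg
  set A := γ.map ⇑σ * γ with hA
  set h := g.map ⇑σ with hh
  have hhu : IsUnit h := hus g hg
  obtain ⟨hh1, hh2⟩ := aux_inv hhu
  have e1 : g * γ = γ₀ * h := by
    rw [← hgγ, ← mul_assoc, ← mul_assoc, hg2, one_mul]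
  have e2 : h * γ.map ⇑σ = γ₀.map ⇑σ * g := by
    rw [hh, ← hmm, e1, hmm, hh, hss]
  have e3 : h * A = ν * h := by
    rw [hA, ← mul_assoc, e2, mul_assoc, e1, ← mul_assoc, ← hγ₀ν]
  have hγA : γ * A = A * γ := by
    rw [hA, ← mul_assoc, hAc]
  obtain ⟨p, hp⟩ := aux_central hγr γ hγA
  have hζp : h * γ * h⁻¹ = aeval ν p := by
    conv_lhs => rw [hp]
    rw [aux_inter e3, mul_assoc, hh2, mul_one]
  have hsγ : γ.map ⇑σ = aeval A (p.map (σ : E →+* E)) := by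
    conv_lhs => rw [hp]
    rw [aux_smap, hAs]
  have hN : β⁻¹ * ((h * γ * h⁻¹).map ⇑σ)ᵀ * β * (h * γ * h⁻¹) = ν := by
    have t1 : β⁻¹ * ((h * γ * h⁻¹).map ⇑σ)ᵀ * β = aeval ν (p.map (σ : E →+* E)) := by
      rw [hζp, aux_smap, aux_transpose, mul_assoc, ← aux_inter hνst.symm, ← mul_assoc, hβ1,
        one_mul]
    rw [t1, ← mul_assoc, ← mul_assoc, ← aux_inter e3, ← hsγ, mul_assoc h, ← hA, e3, mul_assoc,
      hh2, mul_one]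
  refine ⟨h * γ * h⁻¹, (hhu.mul hγu).mul ((Matrix.isUnit_nonsing_inv_iff).2 hhu), ?_, hN, ?_⟩
  · rw [hN, hζp, aux_comm rfl]
  · intro γ' hγ'S h' hh' hc
    rw [hN] at hc
    obtain ⟨hγ'u, -, hγ'r⟩ := hS1 γ' hγ'S
    obtain ⟨hA's, hA'c⟩ := hSn γ' hγ'S
    obtain ⟨hh'1, hh'2⟩ := aux_inv hh'
    have hk : (γ'.map ⇑σ * γ') * (h' * h) = (h' * h) * A := by
      rw [mul_assoc h', e3, hc]
      simp only [← mul_assoc]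
      rw [hh'2, one_mul]
    obtain ⟨X, hXu, hX⟩ := aux_descent σ hσ2 hfix hdeg hγr hA's hAs hγ'u hγu (hh'.mul hhu) rfl
      hA'c rfl hAc hk
    have heq : γ' = γ := by
      refine (hS2 γ' hγ'u hγ'r).unique ⟨hγ'S, 1, isUnit_one, ?_⟩ ⟨hγS, X, hXu, ?_⟩
      · rw [Matrix.map_one _ (map_zero σ) (map_one σ), inv_one, one_mul, mul_one]
      · rw [mul_assoc, hX, ← mul_assoc, (aux_inv hXu).1, one_mul]
    subst heq
    have hkγ : (h' * h) * γ' = γ' * (h' * h) := by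
      conv_lhs => rw [hp]
      conv_rhs => rw [hp]
      exact aux_comm hk.symm p
    calc h * γ' * h⁻¹ = h'⁻¹ * ((h' * h) * γ') * h⁻¹ := by
          simp only [← mul_assoc]; rw [hh'1, one_mul]
      _ = h'⁻¹ * γ' * h' := by
          rw [hkγ]; simp only [mul_assoc]; rw [hh2, mul_one]
end Aux

theorem exists_compatible_unitary_representatives
    {F E : Type*} [Field F] [Field E] [Algebra F E]
    (σ : E ≃ₐ[F] E)
    (hσ2 : ∀ x : E, σ (σ x) = x)
    (hfix : ∀ x : E, σ x = x ↔ x ∈ Set.range (algebraMap F E))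
    (hdeg : Module.finrank F E = 2)
    (n : ℕ) (hn : 1 ≤ n)
    (β : Matrix (Fin n) (Fin n) E) (hβ : IsUnit β)
    (hskew : (β.map ⇑σ)ᵀ = -β)
    (S : Set (Matrix (Fin n) (Fin n) E))
    -- every element of S is an invertible normal matrix with regular semisimple norm
    (hS1 : ∀ γ ∈ S, IsUnit γ ∧
      (∀ i j, ((γ.map ⇑σ) * γ) i j ∈ Set.range (algebraMap F E)) ∧
      IsRegSemisimple ((γ.map ⇑σ) * γ))
    -- S contains exactly one element of each σ-conjugacy class with regular
    -- semisimple norm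
    (hS2 : ∀ δ : Matrix (Fin n) (Fin n) E, IsUnit δ → IsRegSemisimple ((δ.map ⇑σ) * δ) →
      ∃! γ, γ ∈ S ∧ ∃ g : Matrix (Fin n) (Fin n) E, IsUnit g ∧ g⁻¹ * δ * g.map ⇑σ = γ) :
    ∃ R : Set (Matrix (Fin n) (Fin n) E),
      -- (i) every ζ ∈ R is invertible, normal with respect to β, with
      -- β⁻¹ζ*βζ regular semisimple and a norm from GL_n(E)
      (∀ ζ ∈ R, IsUnit ζ ∧
        ζ * (β⁻¹ * (ζ.map ⇑σ)ᵀ * β * ζ) = (β⁻¹ * (ζ.map ⇑σ)ᵀ * β * ζ) * ζ ∧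
        IsRegSemisimple (β⁻¹ * (ζ.map ⇑σ)ᵀ * β * ζ) ∧
        ∃ γ₀ : Matrix (Fin n) (Fin n) E, IsUnit γ₀ ∧
          β⁻¹ * (ζ.map ⇑σ)ᵀ * β * ζ = (γ₀.map ⇑σ) * γ₀) ∧
      -- (ii) R contains exactly one element of each regular semisimple
      -- U_n^β(F) × U_n^β(F)-orbit whose twisted norm is a norm
      (∀ ζ' : Matrix (Fin n) (Fin n) E, IsUnit ζ' →
        IsRegSemisimple (β⁻¹ * (ζ'.map ⇑σ)ᵀ * β * ζ') →
        (∃ γ₀ : Matrix (Fin n) (Fin n) E, IsUnit γ₀ ∧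
          β⁻¹ * (ζ'.map ⇑σ)ᵀ * β * ζ' = (γ₀.map ⇑σ) * γ₀) →
        ∃! ζ, ζ ∈ R ∧
          ∃ g : Matrix (Fin n) (Fin n) E, (IsUnit g ∧ (g.map ⇑σ)ᵀ * β * g = β) ∧
          ∃ h : Matrix (Fin n) (Fin n) E, (IsUnit h ∧ (h.map ⇑σ)ᵀ * β * h = β) ∧
            g⁻¹ * ζ' * h = ζ) ∧
      -- (iii) R is compatible with S
      (∀ γ ∈ S, ∀ ζ ∈ R, ∀ h : Matrix (Fin n) (Fin n) E, IsUnit h →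
        β⁻¹ * (ζ.map ⇑σ)ᵀ * β * ζ = h⁻¹ * ((γ.map ⇑σ) * γ) * h →
        ζ = h⁻¹ * γ * h) := by
  classical
  let U : Matrix (Fin n) (Fin n) E → Prop := fun g => IsUnit g ∧ (g.map ⇑σ)ᵀ * β * g = β
  have hU1 : U 1 := ⟨isUnit_one, by rw [aux_st_one, one_mul, mul_one]⟩
  have hUm : ∀ g h, U g → U h → U (g * h) := by
    rintro g h ⟨hg, hg'⟩ ⟨hh, hh'⟩
    refine ⟨hg.mul hh, ?_⟩
    calc ((g * h).map ⇑σ)ᵀ * β * (g * h) = (h.map ⇑σ)ᵀ * ((g.map ⇑σ)ᵀ * β * g) * h := by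
          rw [aux_st_mul]; simp only [mul_assoc]
      _ = β := by rw [hg', hh']
  have hUi : ∀ g, U g → U g⁻¹ := by
    rintro g ⟨hg, hg'⟩
    refine ⟨(Matrix.isUnit_nonsing_inv_iff).2 hg, ?_⟩
    obtain ⟨h1, h2⟩ := aux_inv hg
    calc ((g⁻¹).map ⇑σ)ᵀ * β * g⁻¹ = ((g⁻¹).map ⇑σ)ᵀ * ((g.map ⇑σ)ᵀ * β * g) * g⁻¹ := by rw [hg']
      _ = ((g * g⁻¹).map ⇑σ)ᵀ * β * (g * g⁻¹) := by rw [aux_st_mul]; simp only [mul_assoc]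
      _ = β := by rw [h2, aux_st_one, one_mul, mul_one]
  let rel : Matrix (Fin n) (Fin n) E → Matrix (Fin n) (Fin n) E → Prop := fun a b =>
    ∃ g, U g ∧ ∃ h, U h ∧ g⁻¹ * a * h = b
  have rrefl : ∀ a, rel a a := fun a => ⟨1, hU1, 1, hU1, by rw [inv_one, one_mul, mul_one]⟩
  have rsymm : ∀ a b, rel a b → rel b a := by
    rintro a b ⟨g, hg, h, hh, rfl⟩
    refine ⟨g⁻¹, hUi g hg, h⁻¹, hUi h hh, ?_⟩
    have hgi : g⁻¹⁻¹ * g⁻¹ = 1 := (aux_inv (hUi g hg).1).1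
    calc g⁻¹⁻¹ * (g⁻¹ * a * h) * h⁻¹ = (g⁻¹⁻¹ * g⁻¹) * a * (h * h⁻¹) := by simp only [mul_assoc]
      _ = a := by rw [hgi, (aux_inv hh.1).2, one_mul, mul_one]
  have rtrans : ∀ a b c, rel a b → rel b c → rel a c := by
    rintro a b c ⟨g, hg, h, hh, rfl⟩ ⟨g', hg', h', hh', rfl⟩
    refine ⟨g * g', hUm _ _ hg hg', h * h', hUm _ _ hh hh', ?_⟩
    rw [Matrix.mul_inv_rev]
    simp only [mul_assoc]
  have rN : ∀ a b, IsUnit a → IsUnit b →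
      β⁻¹ * (b.map ⇑σ)ᵀ * β * b = β⁻¹ * (a.map ⇑σ)ᵀ * β * a → rel a b := by
    intro a b ha hb hab
    obtain ⟨a1, a2⟩ := aux_inv ha
    obtain ⟨b1, b2⟩ := aux_inv hb
    have hab' : (b.map ⇑σ)ᵀ * β * b = (a.map ⇑σ)ᵀ * β * a := by
      have h1 := congrArg (fun M => β * M) hab
      simp only [← mul_assoc] at h1
      rw [(aux_inv hβ).2, one_mul, one_mul] at h1
      exact h1
    refine ⟨a * b⁻¹, ⟨ha.mul ((Matrix.isUnit_nonsing_inv_iff).2 hb), ?_⟩, 1, hU1, ?_⟩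
    · calc ((a * b⁻¹).map ⇑σ)ᵀ * β * (a * b⁻¹)
          = ((b⁻¹).map ⇑σ)ᵀ * ((a.map ⇑σ)ᵀ * β * a) * b⁻¹ := by
            rw [aux_st_mul]; simp only [mul_assoc]
        _ = ((b * b⁻¹).map ⇑σ)ᵀ * β * (b * b⁻¹) := by
            rw [← hab', aux_st_mul]; simp only [mul_assoc]
        _ = β := by rw [b2, aux_st_one, one_mul, mul_one]
    · rw [Matrix.mul_inv_rev, Matrix.nonsing_inv_nonsing_inv _
        ((Matrix.isUnit_iff_isUnit_det _).1 hb), mul_one, mul_assoc, a1, mul_one]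
  let G := {ζ' : Matrix (Fin n) (Fin n) E // IsUnit ζ' ∧
    IsRegSemisimple (β⁻¹ * (ζ'.map ⇑σ)ᵀ * β * ζ') ∧
    ∃ γ₀ : Matrix (Fin n) (Fin n) E, IsUnit γ₀ ∧
      β⁻¹ * (ζ'.map ⇑σ)ᵀ * β * ζ' = (γ₀.map ⇑σ) * γ₀}
  have hex := fun a : G => aux_exists σ hσ2 hfix hdeg n β hβ hskew S hS1 hS2 a.1 a.2.2.1 a.2.2.2
  choose f hf1 hf2 hf3 hf4 using hex
  have hfr : ∀ a : G, rel a.1 (f a) := fun a => rN _ _ a.2.1 (hf1 a) (hf3 a)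
  let st : Setoid G := ⟨fun a b => rel a.1 b.1, fun a => rrefl _, fun h => rsymm _ _ h,
    fun h h' => rtrans _ _ _ h h'⟩
  refine ⟨Set.range (fun q : Quotient st => f q.out), ?_, ?_, ?_⟩
  · rintro _ ⟨q, rfl⟩
    refine ⟨hf1 _, hf2 _, ?_, ?_⟩
    · rw [hf3]; exact q.out.2.2.1
    · rw [hf3]; exact q.out.2.2.2
  · intro ζ' hu hr hn
    let a : G := ⟨ζ', hu, hr, hn⟩
    refine ⟨f (Quotient.mk st a).out, ⟨⟨_, rfl⟩, ?_⟩, ?_⟩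
    · have h1 : rel (Quotient.mk st a).out.1 a.1 := Quotient.mk_out a
      exact rtrans _ _ _ (rsymm _ _ h1) (hfr _)
    · rintro _ ⟨⟨q, rfl⟩, hq⟩
      have h1 : rel ζ' (f q.out) := hq
      have h2 : rel a.1 q.out.1 := rtrans _ _ _ h1 (rsymm _ _ (hfr _))
      have h3 : Quotient.mk st a = q := by
        rw [← Quotient.out_eq q]
        exact Quotient.sound h2
      rw [h3]
  · rintro γ hγ _ ⟨q, rfl⟩ h hh hc
    exact hf4 _ γ hγ h hh hc
end

section
/- Let γ ∈ GL_n(E) be normal and Kottwitz, let β ∈ GL_n(E) be skew-Hermitian, and let ζ ∈ GL_n(E) be Kottwitz with respect to β. Then: (1) if g ∈ GL_n(E) and g⁻¹(σ(γ)γ)g ∈ GL_n(O_E), then g⁻¹γg ∈ GL_n(O_E); (2) if g ∈ GL_n(E) and g⁻¹γσ(g) ∈ GL_n(O_E), then g ∈ GL_n(F)·GL_n(O_E); (3) if h ∈ U_n^β(F) and h⁻¹(β⁻¹ζ*βζ)h ∈ GL_n(O_E), then h⁻¹ζh ∈ GL_n(O_E). -/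
/-!
STATEMENT 8: Properties of Kottwitz elements over an unramified quadratic extension
E/F of nonarchimedean local fields of characteristic zero (encoded as finite
extensions of ℚ_p, with rings of integers the integral closures of ℤ_p, and
unramifiedness encoded by: a uniformizer of O_F stays irreducible in O_E).
-/

open Matrix

/-- `g ∈ GL_n(O_E)`: all entries of `g` and of an inverse of `g` are integral. -/
def InGLnO (p : ℕ) [Fact p.Prime] {E : Type*} [Field E] [Algebra ℤ_[p] E]
    {n : ℕ} (g : Matrix (Fin n) (Fin n) E) : Prop :=
  (∀ i j, g i j ∈ integralClosure ℤ_[p] E) ∧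
  ∃ h : Matrix (Fin n) (Fin n) E, (∀ i j, h i j ∈ integralClosure ℤ_[p] E) ∧
    g * h = 1 ∧ h * g = 1

/-- `γ` is a Kottwitz element: either `γ` is an `O_E`-polynomial in `σ(γ)γ`, or no
`GL_n(E)`-conjugate of `σ(γ)γ` lies in `GL_n(O_E)`. -/
def IsKottwitz (p : ℕ) [Fact p.Prime] {F E : Type*} [Field F] [Field E] [Algebra F E]
    [Algebra ℤ_[p] E] (σ : E ≃ₐ[F] E) {n : ℕ} (γ : Matrix (Fin n) (Fin n) E) : Prop :=
  (∃ c : Fin n → E, (∀ k, c k ∈ integralClosure ℤ_[p] E) ∧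
    γ = ∑ k : Fin n, c k • ((γ.map ⇑σ) * γ) ^ (k : ℕ)) ∨
  ¬ ∃ g : Matrix (Fin n) (Fin n) E, IsUnit g ∧ InGLnO p (g⁻¹ * ((γ.map ⇑σ) * γ) * g)

/-- `ζ` is Kottwitz with respect to a skew-Hermitian matrix `β`: either `ζ` is an
`O_E`-polynomial in `β⁻¹ζ*βζ`, or no `U_n^β(F)`-conjugate of `β⁻¹ζ*βζ` lies in
`GL_n(O_E)`. -/
def IsKottwitzWrt (p : ℕ) [Fact p.Prime] {F E : Type*} [Field F] [Field E] [Algebra F E]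
    [Algebra ℤ_[p] E] (σ : E ≃ₐ[F] E) {n : ℕ}
    (β ζ : Matrix (Fin n) (Fin n) E) : Prop :=
  (∃ c : Fin n → E, (∀ k, c k ∈ integralClosure ℤ_[p] E) ∧
    ζ = ∑ k : Fin n, c k • (β⁻¹ * (ζ.map ⇑σ)ᵀ * β * ζ) ^ (k : ℕ)) ∨
  ¬ ∃ h : Matrix (Fin n) (Fin n) E, (IsUnit h ∧ (h.map ⇑σ)ᵀ * β * h = β) ∧
      InGLnO p (h⁻¹ * (β⁻¹ * (ζ.map ⇑σ)ᵀ * β * ζ) * h)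

theorem kot_exists_theta {R : Type*} [CommRing R] [IsDomain R] [IsDiscreteValuationRing R]
    [Finite (IsLocalRing.ResidueField R)]
    (τ : R →+* R) (hτ : ∀ x, τ (τ x) = x) (π : R) (hπ : Irreducible π) (hτπ : τ π = π)
    (x₀ : R) (hx₀ : τ x₀ ≠ x₀) : ∃ θ : R, IsUnit (θ - τ θ) := by
  by_contra hcon
  push Not at hcon
  have hmem : ∀ x : R, ¬ IsUnit x → π ∣ x := by
    intro x hx
    have h1 : x ∈ IsLocalRing.maximalIdeal R := hx
    rw [hπ.maximalIdeal_eq] at h1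
    exact Ideal.mem_span_singleton.1 h1
  have key : ∀ x : R, ∃ y z : R, τ y = y ∧ x = y + π * z := by
    intro x
    by_cases h2 : IsUnit (2 : R)
    · obtain ⟨c, hc⟩ := h2.exists_right_inv
      have hτc : τ c = c := by
        have h3 : 2 * τ c = 1 := by
          have := congrArg τ hc
          rwa [map_mul, map_one, map_ofNat] at this
        exact h2.mul_left_cancel (h3.trans hc.symm)
      obtain ⟨z, hz⟩ := hmem _ (hcon x)
      refine ⟨c * (x + τ x), c * z, ?_, ?_⟩
      · rw [map_mul, map_add, hτ, hτc]; ring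
      · linear_combination (-x) * hc + c * hz
    · have h20 : (2 : IsLocalRing.ResidueField R) = 0 := by
        have : IsLocalRing.residue R 2 = 0 := (IsLocalRing.residue_eq_zero_iff _).2 h2
        rwa [map_ofNat] at this
      have : CharP (IsLocalRing.ResidueField R) 2 := CharTwo.of_one_ne_zero_of_two_eq_zero one_ne_zero h20
      have hsq : IsSquare (IsLocalRing.residue R x) := FiniteField.isSquare_of_char_two (ringChar.eq _ 2) _
      obtain ⟨w', hw'⟩ := hsq
      obtain ⟨w, rfl⟩ := IsLocalRing.residue_surjective w'
      have h4 : IsLocalRing.residue R (x - w * w) = 0 := by simp [hw']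
      obtain ⟨z1, hz1⟩ := hmem _ ((IsLocalRing.residue_eq_zero_iff _).1 h4)
      obtain ⟨z2, hz2⟩ := hmem _ (hcon w)
      refine ⟨w * τ w, z1 + w * z2, ?_, ?_⟩
      · rw [map_mul, hτ]; ring
      · linear_combination hz1 + w * hz2
  have ind : ∀ (d : ℕ) (x u : R), IsUnit u → x - τ x = π ^ d * u → False := by
    intro d
    induction d with
    | zero => intro x u hu h; exact hcon x (by rw [h]; simpa using hu)
    | succ d ih =>
      intro x u hu h
      obtain ⟨y, z, hy, rfl⟩ := key x
      refine ih z u hu (mul_left_cancel₀ hπ.ne_zero ?_)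
      rw [map_add, map_mul, hy, hτπ] at h
      linear_combination h
  have hne : x₀ - τ x₀ ≠ 0 := sub_ne_zero.2 (Ne.symm hx₀)
  obtain ⟨d, u, hu⟩ := IsDiscreteValuationRing.eq_unit_mul_pow_irreducible hne hπ
  exact ind d x₀ u u.isUnit (by rw [hu]; ring)

theorem kot_exists_m {R : Type*} [CommRing R] [IsLocalRing R] (τ : R →+* R) (θ : R)
    (hθ : IsUnit (θ - τ θ)) {n : ℕ} (U : Matrix (Fin n) (Fin n) R) :
    ∃ m : Matrix (Fin n) (Fin n) R, IsUnit (m + U * m.map τ) := by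
  classical
  let s : Fin n ⊕ Fin n → (Fin n → R) := Sum.elim (fun j => Pi.single j 1) (fun j => Pi.single j θ)
  let v : Fin n ⊕ Fin n → (Fin n → R) := fun k => s k + U *ᵥ (fun i => τ (s k i))
  have hspan : Submodule.span R (Set.range v) = ⊤ := by
    rw [eq_top_iff, ← (Pi.basisFun R (Fin n)).span_eq, Submodule.span_le]
    rintro _ ⟨j, rfl⟩
    obtain ⟨c, hc⟩ := hθ.exists_left_inv
    have h1 : v (Sum.inl j) ∈ Submodule.span R (Set.range v) := Submodule.subset_span ⟨_, rfl⟩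
    have h2 : v (Sum.inr j) ∈ Submodule.span R (Set.range v) := Submodule.subset_span ⟨_, rfl⟩
    have e1 : (fun i => τ (s (Sum.inl j) i)) = Pi.single j 1 := by
      ext i; by_cases h : i = j
      · subst h; simp [s]
      · simp [s, h]
    have e2 : (fun i => τ (s (Sum.inr j) i)) = τ θ • Pi.single j 1 := by
      ext i; by_cases h : i = j
      · subst h; simp [s]
      · simp [s, h]
    have e3 : s (Sum.inr j) = θ • Pi.single j 1 := by
      ext i; by_cases h : i = j
      · subst h; simp [s]
      · simp [s, h]
    have : Pi.basisFun R (Fin n) j = c • (v (Sum.inr j) - τ θ • v (Sum.inl j)) := by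
      have : v (Sum.inr j) - τ θ • v (Sum.inl j) = (θ - τ θ) • Pi.single j 1 := by
        simp only [v]
        rw [e1, e2, e3, Matrix.mulVec_smul]
        simp only [s, Sum.elim_inl, smul_add, sub_smul]
        abel
      rw [this, smul_smul, hc, one_smul, Pi.basisFun_apply]
    rw [this]
    exact Submodule.smul_mem _ _ (Submodule.sub_mem _ h2 (Submodule.smul_mem _ _ h1))
  obtain ⟨κ, a, b, hb⟩ := Module.exists_basis_of_span_of_flat v hspan
  let e : κ ≃ Fin n := b.indexEquiv (Pi.basisFun R (Fin n))
  let b' := b.reindex e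
  refine ⟨Matrix.of fun i j => s (a (e.symm j)) i, ?_⟩
  have h := (Pi.basisFun R (Fin n)).invertibleToMatrix b'
  have h2 : IsUnit ((Pi.basisFun R (Fin n)).toMatrix b') := isUnit_of_invertible _
  convert h2 using 1
  ext i j
  simp [b', hb, v, Module.Basis.toMatrix_apply, Matrix.mul_apply, Matrix.mulVec, dotProduct]

section
variable (p : ℕ) [Fact p.Prime] {E : Type*} [Field E] [Algebra ℚ_[p] E]
    [FiniteDimensional ℚ_[p] E] [Algebra ℤ_[p] E] [IsScalarTower ℤ_[p] ℚ_[p] E]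

theorem kot_integral_iff (x : E) :
    x ∈ integralClosure ℤ_[p] E ↔ spectralNorm ℚ_[p] E x ≤ 1 := by
  have hx : IsIntegral ℚ_[p] x := IsIntegral.of_finite _ _
  rw [spectralNorm, spectralValue_le_one_iff (minpoly.monic hx), mem_integralClosure_iff]
  constructor
  · intro h n
    rw [minpoly.isIntegrallyClosed_eq_field_fractions' ℚ_[p] h]
    simpa using PadicInt.norm_le_one _
  · intro h
    have hl : minpoly ℚ_[p] x ∈ Polynomial.lifts (algebraMap ℤ_[p] ℚ_[p]) := by
      rw [Polynomial.lifts_iff_coeff_lifts]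
      intro n
      exact ⟨⟨_, h n⟩, rfl⟩
    obtain ⟨q, hq, -, hm⟩ := Polynomial.lifts_and_degree_eq_and_monic hl (minpoly.monic hx)
    refine ⟨q, hm, ?_⟩
    rw [IsScalarTower.algebraMap_eq ℤ_[p] ℚ_[p] E, ← Polynomial.eval₂_map, hq]
    exact minpoly.aeval _ _

theorem kot_or (x : E) : x ∈ integralClosure ℤ_[p] E ∨ x⁻¹ ∈ integralClosure ℤ_[p] E := by
  rw [kot_integral_iff, kot_integral_iff]
  by_cases h0 : x = 0
  · left; subst h0; rw [spectralNorm_zero]; exact zero_le_one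
  by_contra! h
  have h1 := spectralAlgNorm_mul (K := ℚ_[p]) x x⁻¹
  rw [mul_inv_cancel₀ h0, spectralAlgNorm_one] at h1
  simp only [spectralAlgNorm_def] at h1
  nlinarith [h.1, h.2]

theorem kot_dvr (π : integralClosure ℤ_[p] E) (hπ : Irreducible π) :
    IsDiscreteValuationRing (integralClosure ℤ_[p] E) := by
  have hfr : IsFractionRing (integralClosure ℤ_[p] E) E :=
    integralClosure.isFractionRing_of_finite_extension ℚ_[p] E
  have : ValuationRing (integralClosure ℤ_[p] E) := by
    rw [ValuationRing.iff_isInteger_or_isInteger _ E]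
    intro x
    rcases kot_or p x with h | h
    · exact Or.inl ⟨⟨x, h⟩, rfl⟩
    · exact Or.inr ⟨⟨_, h⟩, rfl⟩
  have : IsDedekindDomain (integralClosure ℤ_[p] E) :=
    integralClosure.isDedekindDomain ℤ_[p] ℚ_[p] E
  have hnf : ¬ IsField (integralClosure ℤ_[p] E) := by
    intro h
    let := h.toField
    exact hπ.not_isUnit (isUnit_iff_ne_zero.2 hπ.ne_zero)
  have h1 : IsDiscreteValuationRing (integralClosure ℤ_[p] E) ↔
      IsDedekindDomain (integralClosure ℤ_[p] E) :=
    (IsDiscreteValuationRing.TFAE (integralClosure ℤ_[p] E) hnf).out 0 2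
  exact h1.2 inferInstance

theorem kot_finite [IsLocalRing (integralClosure ℤ_[p] E)] :
    Finite (IsLocalRing.ResidueField (integralClosure ℤ_[p] E)) := by
  have : Module.Finite ℤ_[p] (integralClosure ℤ_[p] E) :=
    IsIntegralClosure.finite ℤ_[p] ℚ_[p] E _
  have : FaithfulSMul ℤ_[p] E := by
    rw [faithfulSMul_iff_algebraMap_injective, IsScalarTower.algebraMap_eq ℤ_[p] ℚ_[p] E]
    exact (algebraMap ℚ_[p] E).injective.comp Subtype.val_injective
  have : IsLocalHom (algebraMap ℤ_[p] (integralClosure ℤ_[p] E)) := inferInstance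
  have hf : Finite (IsLocalRing.ResidueField ℤ_[p]) :=
    Finite.of_equiv _ (PadicInt.residueField (p := p)).symm.toEquiv
  exact IsLocalRing.ResidueField.finite_of_finite (R := ℤ_[p]) hf

theorem kot_InGLnO_iff {n : ℕ} (g : Matrix (Fin n) (Fin n) E) :
    InGLnO p g ↔ ∃ G : Matrix (Fin n) (Fin n) (integralClosure ℤ_[p] E), IsUnit G ∧
      G.map (algebraMap (integralClosure ℤ_[p] E) E) = g := by
  have hinj : Function.Injective (algebraMap (integralClosure ℤ_[p] E) E) :=
    Subtype.val_injective
  constructor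
  · rintro ⟨h1, h, h2, h3, h4⟩
    let G : Matrix (Fin n) (Fin n) (integralClosure ℤ_[p] E) := Matrix.of fun i j => ⟨g i j, h1 i j⟩
    let H : Matrix (Fin n) (Fin n) (integralClosure ℤ_[p] E) := Matrix.of fun i j => ⟨h i j, h2 i j⟩
    have eG : G.map (algebraMap (integralClosure ℤ_[p] E) E) = g := rfl
    have eH : H.map (algebraMap (integralClosure ℤ_[p] E) E) = h := rfl
    refine ⟨G, ?_, eG⟩
    refine IsUnit.of_mul_eq_one H ?_
    apply Matrix.map_injective hinj
    beta_reduce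
    rw [Matrix.map_mul, eG, eH, h3, Matrix.map_one _ (map_zero _) (map_one _)]
  · rintro ⟨G, hG, rfl⟩
    refine ⟨fun i j => (G i j).2, ?_⟩
    obtain ⟨H, h1, h2⟩ := isUnit_iff_exists.1 hG
    refine ⟨H.map (algebraMap (integralClosure ℤ_[p] E) E), fun i j => (H i j).2, ?_, ?_⟩
    · rw [← Matrix.map_mul, h1, Matrix.map_one _ (map_zero _) (map_one _)]
    · rw [← Matrix.map_mul, h2, Matrix.map_one _ (map_zero _) (map_one _)]

theorem kot_conj_pow {n : ℕ} (g N : Matrix (Fin n) (Fin n) E) (hg : IsUnit g) (k : ℕ) :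
    (g⁻¹ * N * g) ^ k = g⁻¹ * N ^ k * g := by
  have hd : IsUnit g.det := (Matrix.isUnit_iff_isUnit_det g).1 hg
  induction k with
  | zero => simp [Matrix.nonsing_inv_mul _ hd]
  | succ k ih =>
    rw [pow_succ, ih, pow_succ]
    simp only [Matrix.mul_assoc]
    rw [Matrix.mul_nonsing_inv_cancel_left _ _ hd]

theorem kot_conj {n : ℕ} (τ : integralClosure ℤ_[p] E →+* integralClosure ℤ_[p] E)
    (σ : E →+* E) (hτ : ∀ x, ((τ x : integralClosure ℤ_[p] E) : E) = σ x)
    (γ N g : Matrix (Fin n) (Fin n) E) (hg : IsUnit g) (c : Fin n → E)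
    (hc : ∀ k, c k ∈ integralClosure ℤ_[p] E)
    (hγ : γ = ∑ k : Fin n, c k • N ^ (k : ℕ)) (hdet : N.det = σ γ.det * γ.det)
    (hN : InGLnO p (g⁻¹ * N * g)) : InGLnO p (g⁻¹ * γ * g) := by
  have hd : IsUnit g.det := (Matrix.isUnit_iff_isUnit_det g).1 hg
  rw [kot_InGLnO_iff] at hN ⊢
  obtain ⟨M, hM, hMN⟩ := hN
  let ι := algebraMap (integralClosure ℤ_[p] E) E
  have hinj : Function.Injective ι := Subtype.val_injective
  let P : Matrix (Fin n) (Fin n) (integralClosure ℤ_[p] E) :=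
    ∑ k : Fin n, (⟨c k, hc k⟩ : integralClosure ℤ_[p] E) • M ^ (k : ℕ)
  have hP : P.map ι = g⁻¹ * γ * g := by
    have h1 : ι.mapMatrix P = ∑ k : Fin n, c k • (ι.mapMatrix M) ^ (k : ℕ) := by
      rw [map_sum]
      refine Finset.sum_congr rfl fun k _ => ?_
      rw [← map_pow]
      ext i j
      simp [ι]
    change ι.mapMatrix P = _
    have h2 : ι.mapMatrix M = g⁻¹ * N * g := hMN
    rw [h1, h2, hγ, Finset.mul_sum, Finset.sum_mul]
    refine Finset.sum_congr rfl fun k _ => ?_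
    rw [kot_conj_pow _ _ hg]
    simp
  have hdconj : ∀ A : Matrix (Fin n) (Fin n) E, (g⁻¹ * A * g).det = A.det := by
    intro A
    rw [Matrix.det_mul_comm, Matrix.mul_nonsing_inv_cancel_left _ _ hd]
  refine ⟨P, ?_, hP⟩
  have e1 : ι P.det = γ.det := by
    rw [← hdconj γ, ← hP]; exact ι.map_det P
  have e2 : ι M.det = N.det := by
    rw [← hdconj N, ← hMN]; exact ι.map_det M
  have e3 : M.det = τ P.det * P.det := by
    apply hinj
    rw [map_mul, e2, e1, hdet, ← e1]
    congr 1
    exact (hτ _).symm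
  rw [Matrix.isUnit_iff_isUnit_det] at hM ⊢
  rw [e3] at hM
  exact isUnit_of_mul_isUnit_right hM
end

theorem kottwitz_element_properties
    (p : ℕ) [Fact p.Prime] {F E : Type*} [Field F] [Field E]
    [Algebra ℚ_[p] F] [Algebra ℚ_[p] E] [Algebra F E] [IsScalarTower ℚ_[p] F E]
    [FiniteDimensional ℚ_[p] F] [FiniteDimensional ℚ_[p] E]
    [Algebra ℤ_[p] F] [Algebra ℤ_[p] E]
    [IsScalarTower ℤ_[p] ℚ_[p] F] [IsScalarTower ℤ_[p] ℚ_[p] E]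
    (σ : E ≃ₐ[F] E)
    (hσ2 : ∀ x : E, σ (σ x) = x)
    (hfix : ∀ x : E, σ x = x ↔ x ∈ Set.range (algebraMap F E))
    (hdeg : Module.finrank F E = 2)
    -- unramifiedness: some uniformizer of O_F remains irreducible in O_E
    (hunr : ∃ (π : F) (hπ : π ∈ integralClosure ℤ_[p] F)
      (hπE : algebraMap F E π ∈ integralClosure ℤ_[p] E),
      Irreducible (⟨π, hπ⟩ : integralClosure ℤ_[p] F) ∧
      Irreducible (⟨algebraMap F E π, hπE⟩ : integralClosure ℤ_[p] E))
    (n : ℕ) (hn : 1 ≤ n)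
    (γ : Matrix (Fin n) (Fin n) E) (hγ : IsUnit γ)
    (hγnormal : ∀ i j, ((γ.map ⇑σ) * γ) i j ∈ Set.range (algebraMap F E))
    (hγkot : IsKottwitz p σ γ)
    (β : Matrix (Fin n) (Fin n) E) (hβ : IsUnit β)
    (hskew : (β.map ⇑σ)ᵀ = -β)
    (ζ : Matrix (Fin n) (Fin n) E) (hζ : IsUnit ζ)
    (hζkot : IsKottwitzWrt p σ β ζ) :
    -- (1)
    (∀ g : Matrix (Fin n) (Fin n) E, IsUnit g →
      InGLnO p (g⁻¹ * ((γ.map ⇑σ) * γ) * g) → InGLnO p (g⁻¹ * γ * g)) ∧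
    -- (2)
    (∀ g : Matrix (Fin n) (Fin n) E, IsUnit g →
      InGLnO p (g⁻¹ * γ * g.map ⇑σ) →
      ∃ a b : Matrix (Fin n) (Fin n) E,
        (IsUnit a ∧ ∀ i j, a i j ∈ Set.range (algebraMap F E)) ∧
        InGLnO p b ∧ g = a * b) ∧
    -- (3)
    (∀ h : Matrix (Fin n) (Fin n) E, (IsUnit h ∧ (h.map ⇑σ)ᵀ * β * h = β) →
      InGLnO p (h⁻¹ * (β⁻¹ * (ζ.map ⇑σ)ᵀ * β * ζ) * h) →
      InGLnO p (h⁻¹ * ζ * h)) := by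
  have hσO : ∀ x : E, x ∈ integralClosure ℤ_[p] E → σ x ∈ integralClosure ℤ_[p] E := by
    intro x hx
    let σ' : E →ₐ[ℚ_[p]] E := (σ.restrictScalars ℚ_[p]).toAlgHom
    exact IsIntegral.map (σ'.restrictScalars ℤ_[p]) hx
  let τ : integralClosure ℤ_[p] E →+* integralClosure ℤ_[p] E :=
    ((σ : E →+* E).comp (integralClosure ℤ_[p] E).toSubring.subtype).codRestrict
      (integralClosure ℤ_[p] E).toSubring (fun x => hσO _ x.2)
  have hτσ : ∀ x, ((τ x : integralClosure ℤ_[p] E) : E) = (σ : E →+* E) x := fun x => rfl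
  have hmapdet : ∀ A : Matrix (Fin n) (Fin n) E, (A.map ⇑σ).det = σ A.det := by
    intro A
    exact ((σ : E →+* E).map_det A).symm
  have hmm : ∀ A B : Matrix (Fin n) (Fin n) E, (A * B).map ⇑σ = A.map ⇑σ * B.map ⇑σ := by
    intro A B
    exact Matrix.map_mul (f := (σ : E →+* E))
  have hm2 : ∀ A : Matrix (Fin n) (Fin n) E, (A.map ⇑σ).map ⇑σ = A := by
    intro A; ext i j; exact hσ2 _
  have part1 : ∀ g : Matrix (Fin n) (Fin n) E, IsUnit g →
      InGLnO p (g⁻¹ * ((γ.map ⇑σ) * γ) * g) → InGLnO p (g⁻¹ * γ * g) := by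
    intro g hg hN
    rcases hγkot with ⟨c, hc, h⟩ | h
    · refine kot_conj p τ (σ : E →+* E) hτσ γ _ g hg c hc h ?_ hN
      rw [Matrix.det_mul, hmapdet]; rfl
    · exact absurd ⟨g, hg, hN⟩ h
  refine ⟨part1, ?_, ?_⟩
  · intro g hg hk
    have hdg : IsUnit g.det := (Matrix.isUnit_iff_isUnit_det g).1 hg
    have hdγ : IsUnit γ.det := (Matrix.isUnit_iff_isUnit_det γ).1 hγ
    obtain ⟨K, hK, hKk⟩ := (kot_InGLnO_iff p _).1 hk
    have hcomm : γ * γ.map ⇑σ = γ.map ⇑σ * γ := by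
      have h1 : (γ.map ⇑σ * γ).map ⇑σ = γ.map ⇑σ * γ := by
        ext i j
        exact (hfix _).2 (hγnormal i j)
      rwa [hmm, hm2] at h1
    have hginv : (g⁻¹).map ⇑σ * g.map ⇑σ = 1 := by
      rw [← hmm, Matrix.nonsing_inv_mul _ hdg, Matrix.map_one _ (map_zero _) (map_one _)]
    have hginv' : g.map ⇑σ * (g⁻¹).map ⇑σ = 1 := by
      rw [← hmm, Matrix.mul_nonsing_inv _ hdg, Matrix.map_one _ (map_zero _) (map_one _)]
    have hNint : InGLnO p (g⁻¹ * ((γ.map ⇑σ) * γ) * g) := by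
      rw [kot_InGLnO_iff]
      refine ⟨K * τ.mapMatrix K, hK.mul (hK.map τ.mapMatrix), ?_⟩
      have h2 : (τ.mapMatrix K).map (algebraMap (integralClosure ℤ_[p] E) E) =
          (g⁻¹ * γ * g.map ⇑σ).map ⇑σ := by
        rw [← hKk]; rfl
      rw [Matrix.map_mul, hKk, h2, hmm, hmm, hm2, ← hcomm]
      calc g⁻¹ * γ * g.map ⇑σ * ((g⁻¹).map ⇑σ * γ.map ⇑σ * g)
          = g⁻¹ * γ * (g.map ⇑σ * (g⁻¹).map ⇑σ) * γ.map ⇑σ * g := by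
            simp only [Matrix.mul_assoc]
        _ = _ := by rw [hginv']; simp only [Matrix.mul_assoc, Matrix.one_mul]
    obtain ⟨P, hP, hPγ⟩ := (kot_InGLnO_iff p _).1 (part1 g hg hNint)
    obtain ⟨Q, hPQ, hQP⟩ := isUnit_iff_exists.1 hP
    let ι := algebraMap (integralClosure ℤ_[p] E) E
    -- `U = g⁻¹ σ(g)` is integral
    let U := Q * K
    have hU : g * U.map ι = g.map ⇑σ := by
      have h3 : P.map ι * U.map ι = K.map ι := by
        rw [← Matrix.map_mul, ← Matrix.mul_assoc, hPQ, Matrix.one_mul]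
      rw [hPγ, hKk] at h3
      have h4 : γ * (g * U.map ι) = γ * g.map ⇑σ := by
        have h5 := congrArg (fun X => g * X) h3
        simp only [Matrix.mul_assoc] at h5
        rwa [Matrix.mul_nonsing_inv_cancel_left _ _ hdg,
          Matrix.mul_nonsing_inv_cancel_left _ _ hdg] at h5
      exact hγ.mul_left_cancel h4
    obtain ⟨π, -, hπE, -, hirr⟩ := hunr
    have := kot_dvr p _ hirr
    have := kot_finite p (E := E)
    obtain ⟨x₀, hx₀⟩ : ∃ x₀ : integralClosure ℤ_[p] E, τ x₀ ≠ x₀ := by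
      by_contra! hall
      have hallE : ∀ x : E, σ x = x := by
        intro x
        rcases kot_or p x with h | h
        · exact congrArg Subtype.val (hall ⟨x, h⟩)
        · have h1 : σ x⁻¹ = x⁻¹ := congrArg Subtype.val (hall ⟨_, h⟩)
          rw [map_inv₀] at h1
          exact inv_injective h1
      have h1 : (⊥ : Subalgebra F E) = ⊤ := by
        rw [eq_top_iff]
        intro x _
        exact Algebra.mem_bot.2 ((hfix x).1 (hallE x))
      have h2 := Subalgebra.bot_eq_top_iff_finrank_eq_one.1 h1
      omega
    obtain ⟨θ, hθ⟩ := kot_exists_theta τ (fun x => Subtype.ext (hσ2 _)) _ hirr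
      (Subtype.ext (σ.commutes π)) x₀ hx₀
    obtain ⟨m, hm⟩ := kot_exists_m τ θ hθ U
    obtain ⟨B, hB1, hB2⟩ := isUnit_iff_exists.1 hm
    have hmσ : (m.map τ).map ι = (m.map ι).map ⇑σ := rfl
    have htr : g * (m + U * m.map τ).map ι = g * m.map ι + (g * m.map ι).map ⇑σ := by
      rw [Matrix.map_add _ (map_add ι), Matrix.map_mul, hmσ, Matrix.mul_add, ← Matrix.mul_assoc,
        hU, hmm]
    refine ⟨g * (m + U * m.map τ).map ι, B.map ι, ⟨?_, ?_⟩, ?_, ?_⟩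
    · exact hg.mul (hm.map ι.mapMatrix)
    · intro i j
      rw [htr, ← hfix]
      simp only [Matrix.add_apply, Matrix.map_apply, map_add, hσ2]
      exact add_comm _ _
    · exact (kot_InGLnO_iff p _).2 ⟨B, IsUnit.of_mul_eq_one _ hB2, rfl⟩
    · rw [Matrix.mul_assoc, ← Matrix.map_mul, hB1, Matrix.map_one _ (map_zero _) (map_one _),
        Matrix.mul_one]
  · intro h hh hN
    rcases hζkot with ⟨c, hc, hz⟩ | hz
    · refine kot_conj p τ (σ : E →+* E) hτσ ζ _ h hh.1 c hc hz ?_ hN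
      have hdβ : IsUnit β.det := (Matrix.isUnit_iff_isUnit_det β).1 hβ
      rw [Matrix.det_mul, Matrix.mul_assoc, Matrix.det_mul_comm,
        Matrix.mul_nonsing_inv_cancel_right _ _ hdβ, Matrix.det_transpose, hmapdet]
      rfl
    · exact absurd ⟨h, hh, hN⟩ hz
end
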